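/- arXiv:2007.09940 — 5 statements merged into one kernel-verified Lean document; each statement's English description precedes it below -/
import Mathlib

section
/- Let k ≥ 0 and let y ∈ F_k. If y ∈ F'_k, then y + f_{2k+3} ∈ F_k and no element of F_k lies strictly between y and y + f_{2k+3}. If y ∈ F''_k, then y + f_{2k+2} ∈ F_k and no element of F_k lies strictly between y and y + f_{2k+2}. In other words, the immediate successor of y in F_k is y + f_{2k+3} when y ∈ F'_k and y + f_{2k+2} when y ∈ F''_k. -/
/-- The substitution τ: 1 → 101, 0 → 1 on the alphabet {0,1}. -/
def tau (b : ℕ) : List ℕ := if b = 1 then [1, 0, 1] else [1]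

/-- The iterated word τ^n(1). -/
def tauIter : ℕ → List ℕ
  | 0 => [1]
  | n + 1 => ((tauIter n).map tau).flatten

/-- `s` is the fixed point of τ beginning with 1: it agrees with every
iterate `τ^n(1)` on its length. -/
def IsFixedSeq (s : ℕ → ℕ) : Prop :=
  ∀ n j, j < (tauIter n).length → s j = (tauIter n).getD j 0

/-- The sequence (f_n): f_0 = 1, f_1 = 2, f_{2n+2} = f_{2n} + f_{2n+1},
f_{2n+3} = f_{2n} + f_{2n+2}. -/
def IsFSeq (f : ℕ → ℕ) : Prop :=
  f 0 = 1 ∧ f 1 = 2 ∧ (∀ n, f (2*n+2) = f (2*n) + f (2*n+1)) ∧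
    (∀ n, f (2*n+3) = f (2*n) + f (2*n+2))

/-- `a` is the f-representation of `n`: digits in {0,1}, finitely supported,
a_i a_{i+1} = 0 for all i, a_i a_{i+2} = 0 for even i, and n = Σ a_i f_i. -/
def IsFRep (f : ℕ → ℕ) (n : ℕ) (a : ℕ → ℕ) : Prop :=
  (∀ i, a i ≤ 1) ∧ (∀ i, a i * a (i+1) = 0) ∧
  (∀ i, Even i → a i * a (i+2) = 0) ∧
  ∃ N, (∀ i, N ≤ i → a i = 0) ∧ n = ∑ i ∈ Finset.range N, a i * f i

/-- The truncated f-representation Φ_k(n) = Σ_{i=0}^{2k+2} a_i(n) f_i. -/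
def Phi (f : ℕ → ℕ) (a : ℕ → ℕ → ℕ) (k n : ℕ) : ℕ :=
  ∑ i ∈ Finset.range (2*k+3), a n i * f i

/-- The Hankel determinant H_{m,n} = det (s_{m+i+j})_{0 ≤ i,j ≤ n-1}. -/
def H (s : ℕ → ℕ) (m n : ℕ) : ℤ :=
  (Matrix.of fun i j : Fin n => (s (m + i.1 + j.1) : ℤ)).det

theorem fs_pos (f : ℕ → ℕ) (hf : IsFSeq f) : ∀ n, 0 < f (2*n) ∧ 0 < f (2*n+1) ∧ f (2*n) < f (2*n+1) := by
  obtain ⟨h0, h1, h2, h3⟩ := hf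
  intro n
  induction n with
  | zero => simp [h0, h1]
  | succ n ih =>
    have := h2 n
    have := h3 n
    rw [show 2*(n+1) = 2*n+2 by ring, show 2*n+2+1 = 2*n+3 by ring]
    omega

theorem fs_mono (f : ℕ → ℕ) (hf : IsFSeq f) : StrictMono f := by
  apply strictMono_nat_of_lt_succ
  intro n
  obtain ⟨t, rfl | rfl⟩ := Nat.even_or_odd' n
  · exact (fs_pos f hf t).2.2
  · have := hf.2.2.1 t
    have := fs_pos f hf t
    rw [show 2*t+1+1 = 2*t+2 by ring]
    omega

/-- Admissible digit strings. -/
def Adm (a : ℕ → ℕ) : Prop :=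
  (∀ i, a i ≤ 1) ∧ (∀ i, a i * a (i+1) = 0) ∧ (∀ i, Even i → a i * a (i+2) = 0)

theorem adm_bound (f : ℕ → ℕ) (hf : IsFSeq f) (a : ℕ → ℕ) (ha : Adm a) :
    ∀ n, ∑ i ∈ Finset.range (2*n), a i * f i < f (2*n) ∧
      ∑ i ∈ Finset.range (2*n+1), a i * f i < f (2*n+1) := by
  obtain ⟨A1, A2, A3⟩ := ha
  obtain ⟨h0, h1, h2, h3⟩ := id hf
  intro n
  induction n with
  | zero =>
    have := A1 0
    simp [h0, h1]; omega
  | succ n ih =>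
    have e2 := h2 n
    have e3 := h3 n
    have p := fs_pos f hf n
    rw [show 2*(n+1) = 2*n+2 by ring, show 2*n+2+1 = 2*n+3 by ring]
    have b0 := A1 (2*n)
    have b1 := A1 (2*n+1)
    have b2 := A1 (2*n+2)
    have c0 := A2 (2*n)
    have c1 := A2 (2*n+1)
    have c2 := A3 (2*n) (by simp)
    have s1 := Finset.sum_range_succ (fun i => a i * f i) (2*n)
    have s2 := Finset.sum_range_succ (fun i => a i * f i) (2*n+1)
    have s3 := Finset.sum_range_succ (fun i => a i * f i) (2*n+2)
    simp only [show 2*n+1+1 = 2*n+2 by ring, show 2*n+2+1 = 2*n+3 by ring] at *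
    generalize a (2*n) = x at *
    generalize a (2*n+1) = y at *
    generalize a (2*n+2) = z at *
    interval_cases x <;> interval_cases y <;> interval_cases z <;> simp at * <;> omega

theorem adm_lt (f : ℕ → ℕ) (hf : IsFSeq f) (a : ℕ → ℕ) (ha : Adm a) (n : ℕ) :
    ∑ i ∈ Finset.range n, a i * f i < f n := by
  obtain ⟨t, rfl | rfl⟩ := Nat.even_or_odd' n
  · exact (adm_bound f hf a ha t).1
  · exact (adm_bound f hf a ha t).2

theorem adm_uniq (f : ℕ → ℕ) (hf : IsFSeq f) (a b : ℕ → ℕ) (ha : Adm a) (hb : Adm b) (N : ℕ)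
    (h : ∑ i ∈ Finset.range N, a i * f i = ∑ i ∈ Finset.range N, b i * f i) :
    ∀ i < N, a i = b i := by
  induction N with
  | zero => intro i hi; omega
  | succ N ih =>
    rw [Finset.sum_range_succ, Finset.sum_range_succ] at h
    have la := adm_lt f hf a ha N
    have lb := adm_lt f hf b hb N
    have xa := ha.1 N
    have xb := hb.1 N
    have key : a N = b N := by
      generalize a N = x at *
      generalize b N = y at *
      interval_cases x <;> interval_cases y <;> simp at * <;> omega
    rw [key] at h
    intro i hi
    rcases Nat.lt_succ_iff_lt_or_eq.mp hi with h' | rfl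
    · exact ih (by omega) i h'
    · exact key

theorem sum_ext_N (f a : ℕ → ℕ) (N M : ℕ) (hN : N ≤ M) (h : ∀ i, N ≤ i → a i = 0) :
    ∑ i ∈ Finset.range N, a i * f i = ∑ i ∈ Finset.range M, a i * f i := by
  apply Finset.sum_subset
  · intro i hi; simp at *; omega
  · intro i _ hi
    simp at hi
    simp [h i hi]

theorem frep_uniq (f : ℕ → ℕ) (hf : IsFSeq f) (n : ℕ) (a b : ℕ → ℕ) (ha : IsFRep f n a)
    (hb : IsFRep f n b) : a = b := by
  obtain ⟨A1, A2, A3, N, hN, hs⟩ := ha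
  obtain ⟨B1, B2, B3, M, hM, ht⟩ := hb
  rw [sum_ext_N f a N (N+M) (by omega) hN] at hs
  rw [sum_ext_N f b M (N+M) (by omega) hM] at ht
  have := adm_uniq f hf a b ⟨A1, A2, A3⟩ ⟨B1, B2, B3⟩ (N+M) (hs.symm.trans ht)
  funext i
  by_cases hi : i < N + M
  · exact this i hi
  · rw [hN i (by omega), hM i (by omega)]

theorem frep_zero (f : ℕ → ℕ) (hf : IsFSeq f) (n m : ℕ) (a : ℕ → ℕ) (ha : IsFRep f n a)
    (h : n < f m) : ∀ i, m ≤ i → a i = 0 := by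
  obtain ⟨A1, A2, A3, N, hN, hs⟩ := ha
  intro i hi
  by_contra hne
  have hiN : i < N := by
    by_contra hh
    exact hne (hN i (by omega))
  have h1 : a i * f i ≤ ∑ i ∈ Finset.range N, a i * f i :=
    Finset.single_le_sum (f := fun i => a i * f i) (fun _ _ => Nat.zero_le _)
      (Finset.mem_range.mpr hiN)
  have h2 : f m ≤ f i := (fs_mono f hf).monotone hi
  have h3 : f i ≤ a i * f i := Nat.le_mul_of_pos_left _ (by omega)
  omega

/-- Number of integers sharing the high digits of `n`. -/
def cnt (f : ℕ → ℕ) (a : ℕ → ℕ → ℕ) (k n : ℕ) : ℕ :=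
  if a n (2*k+3) = 0 ∧ a n (2*k+4) = 0 then f (2*k+3) else f (2*k+2)

theorem cnt_cases (f : ℕ → ℕ) (hf : IsFSeq f) (a : ℕ → ℕ → ℕ) (k n : ℕ) :
    f (2*k+2) ≤ cnt f a k n ∧ cnt f a k n ≤ f (2*k+3) := by
  have := fs_mono f hf (show 2*k+2 < 2*k+3 by omega)
  unfold cnt
  split_ifs <;> omega

theorem Phi_lt_cnt (f : ℕ → ℕ) (hf : IsFSeq f) (a : ℕ → ℕ → ℕ) (ha : ∀ n, IsFRep f n (a n))
    (k n : ℕ) : Phi f a k n < cnt f a k n := by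
  obtain ⟨A1, A2, A3, -⟩ := ha n
  have l := adm_lt f hf (a n) ⟨A1, A2, A3⟩
  unfold Phi cnt
  split_ifs with h
  · exact l _
  · rw [Finset.sum_range_succ]
    have : a n (2*k+2) = 0 := by
      have c1 := A2 (2*k+2)
      have c2 := A3 (2*k+2) ⟨k+1, by ring⟩
      rw [show 2*k+2+1 = 2*k+3 by ring] at c1
      rw [show 2*k+2+2 = 2*k+4 by ring] at c2
      rcases Nat.mul_eq_zero.mp c1 with h1 | h1
      · exact h1
      rcases Nat.mul_eq_zero.mp c2 with h2 | h2
      · exact h2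
      exact absurd ⟨h1, h2⟩ h
    simpa [this] using l (2*k+2)

theorem Phi_glue (f : ℕ → ℕ) (hf : IsFSeq f) (a : ℕ → ℕ → ℕ) (ha : ∀ n, IsFRep f n (a n))
    (k n r : ℕ) (hr : r < cnt f a k n) :
    Phi f a k n ≤ n ∧ Phi f a k (n - Phi f a k n + r) = r ∧
      cnt f a k (n - Phi f a k n + r) = cnt f a k n := by
  obtain ⟨A1, A2, A3, N, hN, hs⟩ := id (ha n)
  obtain ⟨B1, B2, B3, M, hM, ht⟩ := id (ha r)
  have hz : ∀ i, 2*k+3 ≤ i → a r i = 0 :=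
    frep_zero f hf r _ _ (ha r) (lt_of_lt_of_le hr (cnt_cases f hf a k n).2)
  have hz2 : (a n (2*k+3) = 0 ∧ a n (2*k+4) = 0) ∨ a r (2*k+2) = 0 := by
    by_cases h : a n (2*k+3) = 0 ∧ a n (2*k+4) = 0
    · exact Or.inl h
    · right
      simp only [cnt, h, if_false] at hr
      exact frep_zero f hf r _ _ (ha r) hr _ le_rfl
  set K := 2*k+3 + N + M with hK
  have hs' : n = ∑ i ∈ Finset.range K, a n i * f i := by
    rw [← sum_ext_N f (a n) N K (by omega) hN]; exact hs
  have ht' : r = ∑ i ∈ Finset.range (2*k+3), a r i * f i := by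
    rw [sum_ext_N f (a r) (2*k+3) K (by omega) hz,
      ← sum_ext_N f (a r) M K (by omega) hM]; exact ht
  have split : ∀ g : ℕ → ℕ, ∑ i ∈ Finset.range K, g i =
      ∑ i ∈ Finset.range (2*k+3), g i + ∑ i ∈ Finset.range (N+M), g (2*k+3+i) := by
    intro g
    rw [hK, add_assoc, Finset.sum_range_add]
  have hn : n = Phi f a k n + ∑ i ∈ Finset.range (N+M), a n (2*k+3+i) * f (2*k+3+i) := by
    rw [split] at hs'; exact hs'
  have hle : Phi f a k n ≤ n := by omega
  let c : ℕ → ℕ := fun i => if i < 2*k+3 then a r i else a n i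
  have hc : IsFRep f (n - Phi f a k n + r) c := by
    refine ⟨?_, ?_, ?_, K, ?_, ?_⟩
    · intro i
      simp only [c]; split_ifs
      · exact B1 i
      · exact A1 i
    · intro i
      simp only [c]; split_ifs with h1 h2 h2
      · exact B2 i
      · have : i = 2*k+2 := by omega
        subst this
        rcases hz2 with h | h
        · simp [h.1]
        · simp [h]
      · omega
      · exact A2 i
    · intro i hi
      simp only [c]; split_ifs with h1 h2 h2
      · exact B3 i hi
      · have : i = 2*k+2 := by
          obtain ⟨t, rfl⟩ := hi
          omega
        subst this
        rcases hz2 with h | h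
        · simp [h.2]
        · simp [h]
      · omega
      · exact A3 i hi
    · intro i hi
      simp only [c]
      rw [if_neg (by omega)]
      exact hN i (by omega)
    · rw [split]
      have e1 : ∑ i ∈ Finset.range (2*k+3), c i * f i = r := by
        conv_rhs => rw [ht']
        apply Finset.sum_congr rfl
        intro i hi
        simp only [c]
        rw [if_pos (Finset.mem_range.mp hi)]
      have e2 : ∑ i ∈ Finset.range (N+M), c (2*k+3+i) * f (2*k+3+i) =
          ∑ i ∈ Finset.range (N+M), a n (2*k+3+i) * f (2*k+3+i) := by
        apply Finset.sum_congr rfl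
        intro i _
        simp only [c]
        rw [if_neg (by omega)]
      rw [e1, e2]
      omega
  have heq := frep_uniq f hf _ _ _ (ha (n - Phi f a k n + r)) hc
  refine ⟨hle, ?_, ?_⟩
  · conv_rhs => rw [ht']
    unfold Phi at heq ⊢
    rw [heq]
    apply Finset.sum_congr rfl
    intro i hi
    simp only [c]
    rw [if_pos (Finset.mem_range.mp hi)]
  · unfold cnt
    rw [heq]
    simp [c]

theorem succ_cnt (f : ℕ → ℕ) (hf : IsFSeq f) (a : ℕ → ℕ → ℕ) (ha : ∀ n, IsFRep f n (a n))
    (k y c : ℕ) (hc : c < f (2*k+2)) (hy : Phi f a k y = c) :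
    Phi f a k (y + cnt f a k y) = c ∧
      ∀ z, y < z → z < y + cnt f a k y → Phi f a k z ≠ c := by
  have G := Phi_glue f hf a ha k
  have L := Phi_lt_cnt f hf a ha k
  have C := cnt_cases f hf a k
  have hcy : c ≤ y := by
    have := (G y 0 (by have := L y; omega)).1
    omega
  constructor
  · have h0 : Phi f a k (y - c + cnt f a k y) = 0 := by
      by_contra hne
      obtain ⟨p, hp⟩ := Nat.exists_eq_succ_of_ne_zero hne
      have Ln := L (y - c + cnt f a k y)
      obtain ⟨g1, g2, g3⟩ := G (y - c + cnt f a k y) p (by omega)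
      obtain ⟨q1, q2, q3⟩ := G y (cnt f a k y - 1) (by have := L y; omega)
      rw [hy] at q2 q3
      have e : y - c + cnt f a k y - Phi f a k (y - c + cnt f a k y) + p
          = y - c + (cnt f a k y - 1) := by have := L y; omega
      rw [e] at g2 g3
      omega
    have g := (G (y - c + cnt f a k y) c (by have := C (y - c + cnt f a k y); omega)).2.1
    rw [h0] at g
    rwa [show y - c + cnt f a k y - 0 + c = y + cnt f a k y by omega] at g
  · intro z h1 h2 hz
    have g := (G z 0 (by have := L z; omega)).2.1
    have q := (G y (z - y) (by omega)).2.1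
    rw [hz] at g
    rw [hy] at q
    rw [show y - c + (z - y) = z - c + 0 by omega] at q
    omega

theorem F_successor (f : ℕ → ℕ) (hf : IsFSeq f) (a : ℕ → ℕ → ℕ) (ha : ∀ n, IsFRep f n (a n)) :
    ∀ k y : ℕ, Phi f a k y = f (2*k+1) / 2 →
      ((Phi f a (k+1) y = f (2*k+1) / 2 →
          Phi f a k (y + f (2*k+3)) = f (2*k+1) / 2 ∧
          ∀ z : ℕ, y < z → z < y + f (2*k+3) → Phi f a k z ≠ f (2*k+1) / 2) ∧
       (Phi f a (k+1) y ≠ f (2*k+1) / 2 →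
          Phi f a k (y + f (2*k+2)) = f (2*k+1) / 2 ∧
          ∀ z : ℕ, y < z → z < y + f (2*k+2) → Phi f a k z ≠ f (2*k+1) / 2)) := by
  intro k y hy
  have hc : f (2*k+1) / 2 < f (2*k+2) := by
    have := fs_mono f hf (show 2*k+1 < 2*k+2 by omega)
    omega
  have S := succ_cnt f hf a ha k y _ hc hy
  have e : Phi f a (k+1) y = Phi f a k y + a y (2*k+3) * f (2*k+3) + a y (2*k+4) * f (2*k+4) := by
    unfold Phi
    rw [show 2*(k+1)+3 = 2*k+3+1+1 by ring, Finset.sum_range_succ, Finset.sum_range_succ]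
  have p3 := fs_mono f hf (show 2*k+2 < 2*k+3 by omega)
  have p4 := fs_mono f hf (show 2*k+2 < 2*k+4 by omega)
  constructor
  · intro h
    have h3 : a y (2*k+3) * f (2*k+3) = 0 := by omega
    have h4 : a y (2*k+4) * f (2*k+4) = 0 := by omega
    have h3' : a y (2*k+3) = 0 := by
      rcases Nat.mul_eq_zero.mp h3 with h | h <;> omega
    have h4' : a y (2*k+4) = 0 := by
      rcases Nat.mul_eq_zero.mp h4 with h | h <;> omega
    have : cnt f a k y = f (2*k+3) := by simp [cnt, h3', h4']
    rwa [this] at S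
  · intro h
    have : cnt f a k y = f (2*k+2) := by
      unfold cnt
      rw [if_neg]
      rintro ⟨h3, h4⟩
      apply h
      rw [e, h3, h4, hy]
      simp
    rwa [this] at S
end

section
/- Let k ≥ 0 and let m ≥ 0, n ≥ 1 be integers. (i) If f_{2k}+1 ≤ n ≤ f_{2k+2}−2 and there exists β' ∈ F''_k with β' + f_{2k} + 1 < m+n ≤ β' + f_{2k} + f_{2k+1} − 1, then H_{m,n} = 0. (ii) If f_{2k+1}+1 ≤ n ≤ f_{2k+2}−2 and there exists γ ∈ E'_k with γ − f_{2k} + 1 < m+n ≤ γ − 1, then H_{m,n} = 0. (iii) If f_{2k}+1 ≤ n ≤ f_{2k+3}−2 and there exists α ∈ E'_{k+1} with α − f_{2k+2} + 1 < m+n ≤ α − 1, then H_{m,n} = 0. -/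
/-- Level `k` block of the letter `b` (`true` is the letter 1, `false` is the letter 0). -/
def blk : ℕ → Bool → List ℕ
  | 0, true => [1]
  | 0, false => [0]
  | k + 1, true => blk k true ++ (blk k false ++ blk k true)
  | k + 1, false => blk k true

theorem flatten_map_tau_blk (k : ℕ) (b : Bool) :
    ((blk k b).map tau).flatten = blk (k + 1) b := by
  induction k generalizing b with
  | zero => cases b <;> simp [blk, tau]
  | succ k ih =>
    cases b
    · simpa [blk] using ih true
    · have h1 := ih true
      have h2 := ih false
      rw [show blk (k + 1) true = blk k true ++ (blk k false ++ blk k true) from rfl]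
      simp only [List.map_append, List.flatten_append, h1, h2]
      rfl

theorem tauIter_eq_blk (k : ℕ) : tauIter k = blk k true := by
  induction k with
  | zero => rfl
  | succ k ih => rw [tauIter, ih, flatten_map_tau_blk]

/-- The word `w` occurs in `s` at position `p`. -/
def Occ (s : ℕ → ℕ) (p : ℕ) (w : List ℕ) : Prop :=
  ∀ i, i < w.length → s (p + i) = w.getD i 0

theorem occ_append {s : ℕ → ℕ} {p : ℕ} {u v : List ℕ} :
    Occ s p (u ++ v) ↔ Occ s p u ∧ Occ s (p + u.length) v := by
  constructor
  · intro h
    refine ⟨fun i hi => ?_, fun i hi => ?_⟩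
    · rw [h i (by simp; omega), List.getD_append _ _ _ _ hi]
    · rw [add_assoc, h (u.length + i) (by simp; omega),
        List.getD_append_right _ _ _ _ (by omega)]
      congr 1
      omega
  · rintro ⟨h1, h2⟩ i hi
    by_cases hu : i < u.length
    · rw [h1 i hu, List.getD_append _ _ _ _ hu]
    · rw [List.getD_append_right _ _ _ _ (by omega), ← h2 _ (by simp at hi; omega)]
      congr 1
      omega

theorem blk_length {f : ℕ → ℕ} (hf : IsFSeq f) (k : ℕ) :
    (blk k true).length = f (2 * k) ∧
      (blk k true).length + (blk k false).length = f (2 * k + 1) := by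
  obtain ⟨h0, h1, h2, h3⟩ := hf
  induction k with
  | zero => simp [blk, h0, h1]
  | succ k ih =>
    have e2 := h2 k
    have e3 := h3 k
    rw [show 2 * (k + 1) = 2 * k + 2 by ring, show 2 * k + 2 + 1 = 2 * k + 3 by ring]
    simp only [blk, List.length_append]
    omega

theorem blk_false_le (k : ℕ) :
    1 ≤ (blk k false).length ∧ (blk k false).length ≤ (blk k true).length := by
  induction k with
  | zero => simp [blk]
  | succ k ih => simp only [blk, List.length_append]; omega

/-- The half lengths (Pell numbers). -/
def hl : ℕ → ℕ
  | 0 => 1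
  | k + 1 => (blk k true).length + hl k

theorem two_hl (k : ℕ) : 2 * hl k = (blk k true).length + (blk k false).length := by
  induction k with
  | zero => simp [blk, hl]
  | succ k ih => simp only [blk, hl, List.length_append]; omega

/-- The two products of blocks agree away from the two central positions. -/
theorem blk_comm (k i : ℕ) (h1 : i + 1 ≠ hl k) (h2 : i ≠ hl k) :
    (blk k true ++ blk k false).getD i 0 = (blk k false ++ blk k true).getD i 0 := by
  induction k generalizing i with
  | zero =>
    simp only [hl] at h1 h2
    obtain ⟨j, rfl⟩ : ∃ j, i = j + 2 := ⟨i - 2, by omega⟩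
    simp [blk]
  | succ k ih =>
    simp only [hl] at h1 h2
    have l2 := two_hl k
    simp only [blk, List.append_assoc]
    by_cases hi : i < (blk k true).length
    · rw [List.getD_append _ _ _ _ hi, List.getD_append _ _ _ _ hi]
    · have hi' : (blk k true).length ≤ i := by omega
      rw [List.getD_append_right (blk k true) (blk k false ++ (blk k true ++ blk k true)) _ _ hi',
        List.getD_append_right (blk k true) (blk k true ++ (blk k false ++ blk k true)) _ _ hi',
        ← List.append_assoc (blk k false), ← List.append_assoc (blk k true)]
      have := ih (i - (blk k true).length) (by omega) (by omega)
      by_cases hj : i - (blk k true).length < (blk k true).length + (blk k false).length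
      · rw [List.getD_append (blk k false ++ blk k true) _ _ _ (by simp; omega),
          List.getD_append (blk k true ++ blk k false) _ _ _ (by simp; omega), this]
      · rw [List.getD_append_right (blk k false ++ blk k true) _ _ _ (by simp; omega),
          List.getD_append_right (blk k true ++ blk k false) _ _ _ (by simp; omega)]
        simp [add_comm]

theorem blk_initial (k i : ℕ) (hi : i + 1 < hl k) :
    (blk k true).getD i 0 = (blk k false ++ blk k true).getD i 0 := by
  have l2 := two_hl k
  have l3 := blk_false_le k
  rw [← blk_comm k i (by omega) (by omega), List.getD_append _ _ _ _ (by omega)]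

theorem blk_final (k i : ℕ) (hi : (blk k true).length < i + hl k) :
    (blk k true).getD i 0 = (blk k true ++ blk k false).getD (i + (blk k false).length) 0 := by
  have l2 := two_hl k
  have l3 := blk_false_le k
  rw [blk_comm k _ (by omega) (by omega), List.getD_append_right _ _ _ _ (by omega)]
  congr 1
  omega

/-- Block structure around a position `N`. -/
def BInv (s : ℕ → ℕ) (K N : ℕ) (b : Bool) : Prop :=
  (N = 0 ∨ ∃ c N', N = N' + (blk K c).length ∧ Occ s N' (blk K c)) ∧
    Occ s N (blk K b) ∧ ∃ d, Occ s (N + (blk K b).length) (blk K d)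

theorem occ_first {s : ℕ → ℕ} {K p : ℕ} {d : Bool} (h : Occ s p (blk (K + 1) d)) :
    Occ s p (blk K true) := by
  cases d
  · exact h
  · exact (occ_append.1 h).1

theorem occ_last {s : ℕ → ℕ} {K p : ℕ} {c : Bool} (h : Occ s p (blk (K + 1) c)) :
    ∃ p', p + (blk (K + 1) c).length = p' + (blk K true).length ∧ Occ s p' (blk K true) := by
  cases c
  · exact ⟨p, rfl, h⟩
  · have := (occ_append.1 (occ_append.1 h).2).2
    exact ⟨_, by simp only [blk, List.length_append]; omega, this⟩

theorem binv_left {s : ℕ → ℕ} {K N : ℕ} {b : Bool} (h : BInv s (K + 1) N b) :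
    N = 0 ∨ ∃ N', N = N' + (blk K true).length ∧ Occ s N' (blk K true) := by
  rcases h.1 with h | ⟨c, N', h1, h2⟩
  · exact Or.inl h
  · obtain ⟨p, hp, ho⟩ := occ_last h2
    exact Or.inr ⟨p, by omega, ho⟩

theorem binv_right {s : ℕ → ℕ} {K N : ℕ} {b : Bool} (h : BInv s (K + 1) N b) :
    Occ s (N + (blk (K + 1) b).length) (blk K true) := by
  obtain ⟨d, hd⟩ := h.2.2
  exact occ_first hd

theorem binv_zero {s : ℕ → ℕ} (hs : IsFixedSeq s) (K : ℕ) : BInv s K 0 true := by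
  have h : Occ s 0 (blk (K + 1) true) := by
    intro i hi
    rw [← tauIter_eq_blk] at hi ⊢
    rw [zero_add]
    exact hs _ _ hi
  have h' := occ_append.1 h
  exact ⟨Or.inl rfl, h'.1, false, (occ_append.1 h'.2).1⟩

theorem binv_step0 {s : ℕ → ℕ} {K N : ℕ} {b : Bool} (h : BInv s (K + 1) N b) :
    BInv s K N true := by
  refine ⟨?_, occ_first h.2.1, ?_⟩
  · rcases binv_left h with h | ⟨N', h1, h2⟩
    · exact Or.inl h
    · exact Or.inr ⟨true, N', h1, h2⟩
  · cases b
    · exact ⟨true, binv_right h⟩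
    · exact ⟨false, (occ_append.1 (occ_append.1 h.2.1).2).1⟩

theorem binv_step1 {s : ℕ → ℕ} {K N : ℕ} (h : BInv s (K + 1) N true) :
    BInv s K (N + (blk K true).length) false := by
  have h1 := occ_append.1 h.2.1
  have h2 := occ_append.1 h1.2
  exact ⟨Or.inr ⟨true, N, rfl, h1.1⟩, h2.1, true, h2.2⟩

theorem binv_step2 {s : ℕ → ℕ} {K N : ℕ} (h : BInv s (K + 1) N true) :
    BInv s K (N + ((blk K true).length + (blk K false).length)) true := by
  have h1 := occ_append.1 h.2.1
  have h2 := occ_append.1 h1.2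
  rw [← add_assoc]
  refine ⟨Or.inr ⟨false, _, rfl, h2.1⟩, h2.2, true, ?_⟩
  have := binv_right h
  simpa [blk, add_assoc] using this

theorem binv_digits {f s : ℕ → ℕ} (hf : IsFSeq f) (hs : IsFixedSeq s) {a : ℕ → ℕ}
    (h1 : ∀ i, a i ≤ 1) (h2 : ∀ i, a i * a (i + 1) = 0)
    (h3 : ∀ i, Even i → a i * a (i + 2) = 0) (D : ℕ) :
    ∀ K, (∀ i, 2 * (K + D) ≤ i → a i = 0) →
      BInv s K (∑ i ∈ Finset.Ico (2 * K) (2 * (K + D)), a i * f i) (decide (a (2 * K) = 0)) := by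
  induction D with
  | zero =>
    intro K h
    have : a (2 * K) = 0 := h _ (by omega)
    simpa [this] using binv_zero hs K
  | succ D ih =>
    intro K h
    have I := ih (K + 1) (fun i hi => h i (by omega))
    obtain ⟨l1, l2⟩ := blk_length hf K
    rw [Finset.sum_eq_sum_Ico_succ_bot (by omega), Finset.sum_eq_sum_Ico_succ_bot (by omega)]
    rw [show 2 * K + 1 + 1 = 2 * (K + 1) by ring, show K + (D + 1) = K + 1 + D by ring]
    set S := ∑ i ∈ Finset.Ico (2 * (K + 1)) (2 * (K + 1 + D)), a i * f i
    have a0 := h1 (2 * K)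
    have a1 := h1 (2 * K + 1)
    have b0 := h2 (2 * K)
    have b1 := h2 (2 * K + 1)
    have b2 := h3 (2 * K) (by simp)
    rw [show 2 * K + 1 + 1 = 2 * (K + 1) by ring] at b1
    rw [show 2 * K + 2 = 2 * (K + 1) by ring] at b2
    by_cases c0 : a (2 * K) = 0
    · by_cases c1 : a (2 * K + 1) = 0
      · simpa [c0, c1] using binv_step0 I
      · have c1' : a (2 * K + 1) = 1 := by omega
        have e : a (2 * (K + 1)) = 0 := by simpa [c1'] using b1
        rw [e] at I
        have := binv_step2 I
        rw [l2] at this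
        rw [c0, c1', zero_mul, one_mul, zero_add, add_comm]
        exact this
    · have c0' : a (2 * K) = 1 := by omega
      have c1 : a (2 * K + 1) = 0 := by simpa [c0'] using b0
      have e : a (2 * (K + 1)) = 0 := by simpa [c0'] using b2
      rw [e] at I
      have := binv_step1 I
      rw [l1] at this
      rw [c0', c1, zero_mul, one_mul, zero_add, add_comm]
      exact this

theorem binv_rep {f s : ℕ → ℕ} (hf : IsFSeq f) (hs : IsFixedSeq s) {a : ℕ → ℕ} {n : ℕ}
    (h : IsFRep f n a) (K : ℕ) :
    ∃ N, n = N + ∑ i ∈ Finset.range (2 * K), a i * f i ∧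
      BInv s K N (decide (a (2 * K) = 0)) := by
  obtain ⟨h1, h2, h3, M, hM, hn⟩ := h
  refine ⟨_, ?_, binv_digits hf hs h1 h2 h3 M K (fun i hi => hM i (by omega))⟩
  rw [add_comm, Finset.sum_range_add_sum_Ico _ (by omega), hn]
  refine Finset.sum_subset (fun i hi => ?_) (fun i _ hi => ?_)
  · simp at hi ⊢
    omega
  · simp at hi
    simp [hM i hi]

theorem H_zero_of_period {s : ℕ → ℕ} {m n p A C : ℕ}
    (hper : ∀ i, A ≤ i → i ≤ C → s i = s (i + p)) (hp : 1 ≤ p) (h1 : p + 1 ≤ n)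
    (h2 : A + p < m + n) (h3 : m + n ≤ C + 1) (h4 : A + n ≤ C + 1) : H s m n = 0 := by
  unfold H
  obtain ⟨x, hx1, hx2, hx3, hx4⟩ : ∃ x, m ≤ x ∧ A ≤ x ∧ x + p < m + n ∧ x + n ≤ C + 1 := by
    rcases le_total m A with h | h
    · exact ⟨A, h, le_rfl, h2, h4⟩
    · exact ⟨m, le_rfl, h, by omega, h3⟩
  refine Matrix.det_zero_of_column_eq
    (i := (⟨x - m, by omega⟩ : Fin n)) (j := (⟨x - m + p, by omega⟩ : Fin n)) ?_ ?_
  · intro h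
    simp at h
    omega
  · intro r
    have hr := r.2
    simp only [Matrix.of_apply]
    rw [hper (m + r.1 + (x - m)) (by omega) (by omega)]
    congr 2
    omega

theorem period1 {s : ℕ → ℕ} {k N : ℕ} (h1 : Occ s N (blk (k + 1) true))
    (h2 : Occ s (N + (blk (k + 1) true).length) (blk (k + 1) true)) (i : ℕ)
    (hi1 : N + hl k + 1 ≤ i) (hi2 : i + 2 ≤ N + 3 * hl k + (blk k true).length) :
    s i = s (i + (blk k true).length) := by
  have l2 := two_hl k
  have l3 := blk_false_le k
  rw [show (blk (k + 1) true).length = (blk k true).length +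
    ((blk k false).length + (blk k true).length) by simp [blk]] at h2
  simp only [blk] at h1 h2
  rw [← List.append_assoc, occ_append, List.length_append] at h1
  rw [occ_append] at h2
  have hl3 : (blk k true ++ blk k false).length = 2 * hl k := by simp; omega
  have hl4 : (blk k false ++ blk k true).length = 2 * hl k := by simp; omega
  obtain ⟨ha, hb⟩ := h1
  obtain ⟨hc, hd⟩ := h2
  by_cases c1 : i < N + 2 * hl k
  · have e1 := ha (i - N) (by omega)
    have e2 := hb (i - N - (blk k false).length) (by omega)
    have e3 := blk_final k (i - N - (blk k false).length) (by omega)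
    rw [show i - N - (blk k false).length + (blk k false).length = i - N by omega] at e3
    rw [show N + (i - N) = i by omega] at e1
    rw [show N + ((blk k true).length + (blk k false).length) +
      (i - N - (blk k false).length) = i + (blk k true).length by omega] at e2
    rw [e1, e2, e3]
  · by_cases c2 : i < N + 2 * hl k + (blk k true).length
    · have e1 := hb (i - N - 2 * hl k) (by omega)
      have e2 := hc (i - N - 2 * hl k) (by omega)
      rw [← e2, show N + ((blk k true).length + (blk k false).length) + (i - N - 2 * hl k) = i
        by omega] at e1
      rw [e1]
      congr 1
      omega
    · have e1 := hc (i - N - 2 * hl k - (blk k true).length) (by omega)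
      have e2 := hd (i - N - 2 * hl k - (blk k true).length) (by omega)
      have e3 := blk_initial k (i - N - 2 * hl k - (blk k true).length) (by omega)
      rw [← e2, ← e1] at e3
      convert e3 using 2 <;> omega

theorem period2 {s : ℕ → ℕ} {k N : ℕ} (h : BInv s (k + 1) N true) (i : ℕ)
    (hi1 : N + 1 ≤ i + hl k) (hi2 : i + 2 ≤ N + hl k + (blk k true).length) :
    s i = s (i + 2 * hl k) := by
  have l2 := two_hl k
  have l3 := blk_false_le k
  have hR := binv_right h
  rw [show (blk (k + 1) true).length = (blk k true).length +
    ((blk k false).length + (blk k true).length) by simp [blk]] at hR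
  have hL := binv_left h
  have h0 := h.2.1
  simp only [blk] at h0
  have h0' := h0
  rw [occ_append] at h0
  rw [← List.append_assoc, occ_append, List.length_append] at h0'
  have hl3 : (blk k true ++ blk k false).length = 2 * hl k := by simp; omega
  have hl4 : (blk k false ++ blk k true).length = 2 * hl k := by simp; omega
  obtain ⟨ha, hb⟩ := h0
  obtain ⟨hc, hd⟩ := h0'
  by_cases c0 : i < N
  · rcases hL with hL | ⟨N', hN', ho⟩
    · omega
    · have e1 := ho (i - N') (by omega)
      have e2 := hc (i - N' + (blk k false).length) (by omega)
      have e3 := blk_final k (i - N') (by omega)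
      rw [← e1, ← e2] at e3
      convert e3 using 2 <;> omega
  · by_cases c1 : i < N + (blk k true).length
    · have e1 := ha (i - N) (by omega)
      have e2 := hd (i - N) (by omega)
      rw [← e2] at e1
      convert e1 using 2 <;> omega
    · have e1 := hb (i - N - (blk k true).length) (by omega)
      have e2 := hR (i - N - (blk k true).length) (by omega)
      have e3 := blk_initial k (i - N - (blk k true).length) (by omega)
      rw [← e1, ← e2] at e3
      convert e3.symm using 2 <;> omega

theorem period3 {s : ℕ → ℕ} {k N : ℕ} (h : Occ s N (blk (k + 2) true)) (i : ℕ)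
    (hi1 : N + hl k + 1 ≤ i) (hi2 : i + 2 ≤ N + 3 * hl k + 2 * (blk k true).length) :
    s i = s (i + (blk k true).length) := by
  have l2 := two_hl k
  have l3 := blk_false_le k
  have hl3 : (blk k true ++ blk k false).length = 2 * hl k := by simp; omega
  have hl4 : (blk k false ++ blk k true).length = 2 * hl k := by simp; omega
  have h1 := occ_append.1 h
  have h2 := occ_append.1 h1.2
  rw [show (blk (k + 1) true).length = (blk k true).length +
    ((blk k false).length + (blk k true).length) by simp [blk]] at h2
  obtain ⟨hA, -⟩ := h1
  obtain ⟨hc, hD⟩ := h2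
  simp only [blk] at hA hc hD
  rw [← List.append_assoc, occ_append, List.length_append] at hA
  rw [occ_append] at hD
  obtain ⟨ha, hb⟩ := hA
  obtain ⟨hd, he⟩ := hD
  by_cases c1 : i < N + 2 * hl k
  · have e1 := ha (i - N) (by omega)
    have e2 := hb (i - N - (blk k false).length) (by omega)
    have e3 := blk_final k (i - N - (blk k false).length) (by omega)
    rw [show i - N - (blk k false).length + (blk k false).length = i - N by omega] at e3
    rw [← e1, ← e2] at e3
    convert e3.symm using 2 <;> omega
  · by_cases c2 : i < N + 2 * hl k + (blk k true).length
    · have e1 := hb (i - N - 2 * hl k) (by omega)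
      have e2 := hc (i - N - 2 * hl k) (by omega)
      rw [← e2] at e1
      convert e1 using 2 <;> omega
    · by_cases c3 : i < N + 2 * hl k + 2 * (blk k true).length
      · have e1 := hc (i - N - 2 * hl k - (blk k true).length) (by omega)
        have e2 := hd (i - N - 2 * hl k - (blk k true).length) (by omega)
        rw [← e2] at e1
        convert e1 using 2 <;> omega
      · have e1 := hd (i - N - 2 * hl k - 2 * (blk k true).length) (by omega)
        have e2 := he (i - N - 2 * hl k - 2 * (blk k true).length) (by omega)
        have e3 := blk_initial k (i - N - 2 * hl k - 2 * (blk k true).length) (by omega)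
        rw [← e2, ← e1] at e3
        convert e3 using 2 <;> omega

theorem binv_phi {f s : ℕ → ℕ} (hf : IsFSeq f) (hs : IsFixedSeq s) {a : ℕ → ℕ → ℕ}
    (ha : ∀ n, IsFRep f n (a n)) {k n : ℕ} (h : Phi f a k n < f (2 * k + 2)) :
    a n (2 * k + 2) = 0 ∧ ∃ N, n = N + Phi f a k n ∧ BInv s (k + 1) N true := by
  have h0 : a n (2 * k + 2) = 0 := by
    by_contra hne
    have h1 := (ha n).1 (2 * k + 2)
    have h2 : a n (2 * k + 2) = 1 := by omega
    rw [Phi, Finset.sum_range_succ, h2] at h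
    omega
  refine ⟨h0, ?_⟩
  obtain ⟨N, hN, I⟩ := binv_rep hf hs (ha n) (k + 1)
  rw [show 2 * (k + 1) = 2 * k + 2 by ring] at hN I
  refine ⟨N, ?_, by simpa [h0] using I⟩
  rw [Phi, Finset.sum_range_succ, h0]
  simpa using hN

theorem case1_blocks {f s : ℕ → ℕ} (hf : IsFSeq f) (hs : IsFixedSeq s) {a : ℕ → ℕ → ℕ}
    (ha : ∀ n, IsFRep f n (a n)) {k n : ℕ} (h : Phi f a k n < f (2 * k + 2))
    (h' : Phi f a (k + 1) n ≠ Phi f a k n) :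
    ∃ N, n = N + Phi f a k n ∧ Occ s N (blk (k + 1) true) ∧
      Occ s (N + (blk (k + 1) true).length) (blk (k + 1) true) := by
  obtain ⟨h0, -⟩ := binv_phi hf hs ha h
  obtain ⟨N, hN, I⟩ := binv_rep hf hs (ha n) (k + 2)
  obtain ⟨d1, d2, d3, -⟩ := ha n
  have b1 := d2 (2 * k + 3)
  have a3 := d1 (2 * k + 3)
  have a4 := d1 (2 * k + 4)
  have l := (blk_length hf (k + 1)).2
  have e1 : ∑ i ∈ Finset.range (2 * (k + 2)), a n i * f i =
      Phi f a k n + a n (2 * k + 3) * f (2 * k + 3) := by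
    rw [show 2 * (k + 2) = 2 * k + 3 + 1 by ring, Finset.sum_range_succ, Phi]
  have e2 : Phi f a (k + 1) n = Phi f a k n + a n (2 * k + 3) * f (2 * k + 3) +
      a n (2 * k + 4) * f (2 * k + 4) := by
    rw [Phi, show 2 * (k + 1) + 3 = 2 * k + 3 + 1 + 1 by ring, Finset.sum_range_succ,
      Finset.sum_range_succ, Phi]
  rw [show 2 * (k + 2) = 2 * k + 4 by ring] at I
  rw [e1] at hN
  rw [show 2 * k + 3 + 1 = 2 * k + 4 by ring] at b1
  rw [show 2 * (k + 1) + 1 = 2 * k + 3 by ring] at l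
  by_cases c : a n (2 * k + 3) = 0
  · have c4 : a n (2 * k + 4) = 1 := by
      by_contra hne
      have : a n (2 * k + 4) = 0 := by omega
      apply h'
      rw [e2, c, this]
      simp
    simp only [c4] at I
    refine ⟨N, by simpa [c] using hN, I.2.1, binv_right I⟩
  · have c3 : a n (2 * k + 3) = 1 := by omega
    have c4 : a n (2 * k + 4) = 0 := by simpa [c3] using b1
    rw [c4] at I
    have h1 := occ_append.1 I.2.1
    have h2 := occ_append.1 h1.2
    refine ⟨N + f (2 * k + 3), by rw [c3] at hN; omega, ?_, ?_⟩
    · rw [← l, ← add_assoc]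
      exact h2.2
    · have := binv_right I
      rw [← l]
      have e : (blk (k + 2) true).length = (blk (k + 1) true).length +
          ((blk (k + 1) false).length + (blk (k + 1) true).length) := by
        rw [show blk (k + 2) true = blk (k + 1) true ++ (blk (k + 1) false ++ blk (k + 1) true)
          from rfl, List.length_append, List.length_append]
      have e' : N + ((blk (k + 1) true).length + (blk (k + 1) false).length) +
          (blk (k + 1) true).length = N + (blk (k + 2) true).length := by omega
      rw [e']
      exact this

theorem hankel_vanishes_inside (f : ℕ → ℕ) (hf : IsFSeq f) (s : ℕ → ℕ) (hs : IsFixedSeq s) (a : ℕ → ℕ → ℕ) (ha : ∀ n, IsFRep f n (a n)) :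
    ∀ k m n : ℕ, 1 ≤ n →
      ((f (2*k) + 1 ≤ n ∧ n ≤ f (2*k+2) - 2 ∧
          ∃ β' : ℕ, (Phi f a k β' = f (2*k+1) / 2 ∧ Phi f a (k+1) β' ≠ f (2*k+1) / 2) ∧
            β' + f (2*k) + 1 < m + n ∧ m + n ≤ β' + f (2*k) + f (2*k+1) - 1) →
        H s m n = 0) ∧
      ((f (2*k+1) + 1 ≤ n ∧ n ≤ f (2*k+2) - 2 ∧
          ∃ γ : ℕ, Phi f a k γ = f (2*k+3) / 2 ∧
            γ - f (2*k) + 1 < m + n ∧ m + n ≤ γ - 1) →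
        H s m n = 0) ∧
      ((f (2*k) + 1 ≤ n ∧ n ≤ f (2*k+3) - 2 ∧
          ∃ α : ℕ, Phi f a (k+1) α = f (2*k+5) / 2 ∧
            α - f (2*k+2) + 1 < m + n ∧ m + n ≤ α - 1) →
        H s m n = 0) := by
  intro k m n hn
  obtain ⟨l1, l2⟩ := blk_length hf k
  obtain ⟨l3, l4⟩ := blk_length hf (k + 1)
  have l5 := (blk_length hf (k + 2)).1
  have l6 := (blk_length hf (k + 2)).2
  have t1 := two_hl k
  have t2 := two_hl (k + 1)
  have t3 := two_hl (k + 2)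
  have q1 : hl (k + 1) = (blk k true).length + hl k := rfl
  have q2 : hl (k + 2) = (blk (k + 1) true).length + hl (k + 1) := rfl
  have g := blk_false_le k
  have w1 : (blk (k + 1) true).length = (blk k true).length +
    ((blk k false).length + (blk k true).length) := by simp [blk]
  have w2 : (blk (k + 2) true).length = (blk (k + 1) true).length +
    ((blk k true).length + (blk (k + 1) true).length) := by simp [blk]; omega
  rw [show 2 * (k + 1) = 2 * k + 2 by ring] at l3 l4
  rw [show 2 * (k + 2) = 2 * k + 4 by ring] at l5 l6
  rw [show 2 * k + 2 + 1 = 2 * k + 3 by ring] at l4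
  rw [show 2 * k + 4 + 1 = 2 * k + 5 by ring] at l6
  refine ⟨?_, ?_, ?_⟩
  · rintro ⟨hn1, hn2, β, ⟨hb1, hb2⟩, hm1, hm2⟩
    obtain ⟨N, hN, o1, o2⟩ := case1_blocks hf hs ha (k := k) (n := β) (by omega) (by omega)
    exact H_zero_of_period (p := (blk k true).length) (A := β + 1)
      (C := N + 3 * hl k + (blk k true).length - 2)
      (fun i hi1 hi2 => period1 o1 o2 i (by omega) (by omega))
      (by omega) (by omega) (by omega) (by omega) (by omega)
  · rintro ⟨hn1, hn2, γ, hg, hm1, hm2⟩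
    obtain ⟨-, N, hN, I⟩ := binv_phi hf hs ha (k := k) (n := γ) (by omega)
    exact H_zero_of_period (p := 2 * hl k) (A := N + 1 - hl k)
      (C := N + hl k + (blk k true).length - 2)
      (fun i hi1 hi2 => period2 I i (by omega) (by omega))
      (by omega) (by omega) (by omega) (by omega) (by omega)
  · rintro ⟨hn1, hn2, α, hg, hm1, hm2⟩
    obtain ⟨-, N, hN, I⟩ := binv_phi hf hs ha (k := k + 1) (n := α)
      (by rw [show 2 * (k + 1) + 2 = 2 * k + 4 by ring]; omega)
    exact H_zero_of_period (p := (blk k true).length) (A := N + hl k + 1)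
      (C := N + 3 * hl k + 2 * (blk k true).length - 2)
      (fun i hi1 hi2 => period3 I.2.1 i (by omega) (by omega))
      (by omega) (by omega) (by omega) (by omega) (by omega)
end

section
/- Let k ≥ 0. For every β' ∈ F''_k and every integer r with 1 ≤ r ≤ f_{2k+1}, and for every α ∈ E'_{k+1} and every integer r' with 1 ≤ r' ≤ f_{2k+2}, one has H_{β'+r, f_{2k}} = H_{α−f_{2k+3}+r', f_{2k}} = H_{f_{2k+5}/2 − f_{2k}, f_{2k}}. (Here f_{2k+5}/2 is the smallest element of E'_{k+1}, so all Hankel determinants of order f_{2k} sitting on the bottom edges of the parallelograms U_{k,i} and V_{k,i} are equal.) -/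
/-- Structural form of being a fixed point: `g j` is the position of `τ(s_j)` in `s`. -/
structure GoodSeq (s g : ℕ → ℕ) : Prop where
  g0 : g 0 = 0
  bin : ∀ j, s j = 0 ∨ s j = 1
  s0 : s 0 = 1
  g1 : ∀ j, s j = 1 → g (j+1) = g j + 3
  gz : ∀ j, s j = 0 → g (j+1) = g j + 1
  first : ∀ j, s (g j) = 1
  second : ∀ j, s j = 1 → s (g j + 1) = 0
  third : ∀ j, s j = 1 → s (g j + 2) = 1

def gpos (s : ℕ → ℕ) : ℕ → ℕ
  | 0 => 0
  | j + 1 => gpos s j + (tau (s j)).length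

theorem tauIter_bin (n : ℕ) : ∀ b ∈ tauIter n, b = 0 ∨ b = 1 := by
  induction n with
  | zero => simp [tauIter]
  | succ n ih =>
    intro b hb
    simp only [tauIter, List.mem_flatten, List.mem_map] at hb
    obtain ⟨l, ⟨c, _, rfl⟩, hb⟩ := hb
    unfold tau at hb
    split_ifs at hb <;> simp at hb <;> tauto

theorem flat_len (l : List ℕ) : l.length ≤ ((l.map tau).flatten).length := by
  induction l with
  | nil => simp
  | cons b l ih =>
    have : 1 ≤ (tau b).length := by unfold tau; split_ifs <;> simp
    simp only [List.map_cons, List.flatten_cons, List.length_append, List.length_cons]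
    omega

theorem tauIter_len (n : ℕ) : n + 1 ≤ (tauIter n).length ∧ ∃ t, tauIter n = 1 :: t := by
  induction n with
  | zero => simp [tauIter]
  | succ n ih =>
    obtain ⟨h, t, ht⟩ := ih
    have h2 := flat_len t
    rw [ht] at h
    simp only [List.length_cons] at h
    constructor
    · simp only [tauIter, ht, List.map_cons, List.flatten_cons, List.length_append]
      have : (tau 1).length = 3 := by simp [tau]
      omega
    · exact ⟨0 :: 1 :: (t.map tau).flatten, by simp [tauIter, ht, tau]⟩

theorem gpos_take (s : ℕ → ℕ) (hs : IsFixedSeq s) (n : ℕ) : ∀ j, j ≤ (tauIter n).length →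
    ((((tauIter n).take j).map tau).flatten).length = gpos s j := by
  intro j
  induction j with
  | zero => simp [gpos]
  | succ j ih =>
    intro hj
    have h1 := hs n j (by omega)
    have hlt : j < (tauIter n).length := by omega
    rw [List.take_succ_eq_append_getElem hlt, List.map_append, List.flatten_append,
      List.length_append, ih (by omega), gpos, h1]
    simp [List.getD_eq_getElem?_getD, hlt]

theorem s_block (s : ℕ → ℕ) (hs : IsFixedSeq s) (j i : ℕ) (hi : i < (tau (s j)).length) :
    s (gpos s j + i) = (tau (s j)).getD i 0 := by
  have hlt : j < (tauIter j).length := (tauIter_len j).1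
  have h1 := hs j j hlt
  have h2 := gpos_take s hs j j hlt.le
  have h3 : tauIter (j+1) = (((tauIter j).take j).map tau).flatten ++ (tau (s j) ++
      (((tauIter j).drop (j+1)).map tau).flatten) := by
    have h4 : tauIter j = (tauIter j).take j ++ s j :: (tauIter j).drop (j+1) := by
      rw [h1, List.getD_eq_getElem _ _ hlt, List.cons_getElem_drop_succ, List.take_append_drop]
    conv_lhs => rw [tauIter, h4]
    simp
  rw [hs (j+1) (gpos s j + i) (by
    rw [h3]; simp only [List.length_append]; omega), h3,
    List.getD_append_right _ _ _ _ (by omega), h2, Nat.add_sub_cancel_left,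
    List.getD_append _ _ _ _ hi]

theorem good_of_fixed (s : ℕ → ℕ) (hs : IsFixedSeq s) : GoodSeq s (gpos s) := by
  have bin : ∀ j, s j = 0 ∨ s j = 1 := by
    intro j
    have hlt : j < (tauIter j).length := (tauIter_len j).1
    rw [hs j j hlt, List.getD_eq_getElem _ _ hlt]
    exact tauIter_bin j _ (List.getElem_mem hlt)
  refine ⟨rfl, bin, ?_, ?_, ?_, ?_, ?_, ?_⟩
  · have := hs 0 0 (by simp [tauIter])
    simpa [tauIter] using this
  · intro j h; simp [gpos, tau, h]
  · intro j h; simp [gpos, tau, h]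
  · intro j
    have := s_block s hs j 0 (by rcases bin j with h | h <;> simp [tau, h])
    rcases bin j with h | h <;> simpa [tau, h] using this
  · intro j h
    have := s_block s hs j 1 (by simp [tau, h])
    simpa [tau, h] using this
  · intro j h
    have := s_block s hs j 2 (by simp [tau, h])
    simpa [tau, h] using this

/-- length of `τ^k(0)` -/
def cc (f : ℕ → ℕ) : ℕ → ℕ
  | 0 => 1
  | k + 1 => f (2*k)

/-- length of the periodic extension -/
def ee (f : ℕ → ℕ) : ℕ → ℕ
  | 0 => 0
  | k + 1 => f (2*k) + ee f k


theorem f_ee {f : ℕ → ℕ} (hf : IsFSeq f)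
    (k : ℕ) : f (2*k+1) = 2 * (ee f k + 1) := by
  obtain ⟨h0, h1, h2, h3⟩ := hf
  induction k with
  | zero => simp [ee, h1]
  | succ k ih =>
    have a := h2 k
    have b := h3 k
    have : 2*(k+1)+1 = 2*k+3 := by ring
    rw [this]
    simp only [ee]
    omega

theorem f_cc {f : ℕ → ℕ} (hf : IsFSeq f)
    (k : ℕ) : f (2*k+1) = f (2*k) + cc f k := by
  obtain ⟨h0, h1, h2, h3⟩ := hf
  cases k with
  | zero => simp [cc, h1, h0]
  | succ k =>
    have b := h3 k
    have h : 2*(k+1)+1 = 2*k+3 := by ring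
    have h' : 2*(k+1) = 2*k+2 := by ring
    rw [h, h']
    simp only [cc]
    omega

theorem f_odd {f : ℕ → ℕ} (hf : IsFSeq f)
    (k : ℕ) : f (2*k) % 2 = 1 := by
  induction k with
  | zero => simp [hf.1]
  | succ k ih =>
    have a := hf.2.2.1 k
    have b := f_ee hf k
    have h' : 2*(k+1) = 2*k+2 := by ring
    rw [h']
    omega

theorem ee_le {f : ℕ → ℕ} (hf : IsFSeq f)
    (k : ℕ) : ee f k < f (2*k) := by
  induction k with
  | zero => simp [hf.1, ee]
  | succ k ih =>
    have a := hf.2.2.1 k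
    have b := f_ee hf k
    have h' : 2*(k+1) = 2*k+2 := by ring
    rw [h']
    simp only [ee]
    omega


theorem iter_step {f : ℕ → ℕ} (hf : IsFSeq f) {s g : ℕ → ℕ} (hg : GoodSeq s g)
    (k : ℕ) : ∀ j, (s j = 1 → g^[k] (j+1) = g^[k] j + f (2*k)) ∧
    (s j = 0 → g^[k] (j+1) = g^[k] j + cc f k) := by
  induction k with
  | zero => intro j; simp [hf.1, cc]
  | succ k ih =>
    intro j
    simp only [Function.iterate_succ, Function.comp]
    constructor
    · intro h
      have a := hf.2.2.1 k
      have b := f_cc hf k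
      have h' : 2*(k+1) = 2*k+2 := by ring
      rw [hg.g1 j h, h', (ih (g j + 2)).1 (hg.third j h), (ih (g j + 1)).2 (hg.second j h),
        (ih (g j)).1 (hg.first j)]
      omega
    · intro h
      rw [hg.gz j h, (ih (g j)).1 (hg.first j)]; rfl

theorem agree {f : ℕ → ℕ} (hf : IsFSeq f) {s g : ℕ → ℕ} (hg : GoodSeq s g)
    (k : ℕ) : ∀ j j', (s j = 1 → s j' = 1 → ∀ i < f (2*k), s (g^[k] j + i) = s (g^[k] j' + i)) ∧
    (s j = 0 → s j' = 0 → ∀ i < cc f k, s (g^[k] j + i) = s (g^[k] j' + i)) := by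
  induction k with
  | zero =>
    intro j j'
    constructor
    · intro h h' i hi
      rw [Nat.mul_zero, hf.1] at hi
      obtain rfl : i = 0 := by omega
      simp [h, h']
    · intro h h' i hi
      simp only [cc] at hi
      obtain rfl : i = 0 := by omega
      simp [h, h']
  | succ k ih =>
    intro j j'
    simp only [Function.iterate_succ, Function.comp]
    constructor
    · intro h h' i hi
      have a := hf.2.2.1 k
      have b := f_cc hf k
      have e : 2*(k+1) = 2*k+2 := by ring
      rw [e] at hi
      have u1 := (iter_step hf hg k (g j)).1 (hg.first j)
      have u2 := (iter_step hf hg k (g j + 1)).2 (hg.second j h)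
      have v1 := (iter_step hf hg k (g j')).1 (hg.first j')
      have v2 := (iter_step hf hg k (g j' + 1)).2 (hg.second j' h')
      rcases lt_or_ge i (f (2*k)) with c | c
      · exact (ih (g j) (g j')).1 (hg.first j) (hg.first j') i c
      rcases lt_or_ge i (f (2*k) + cc f k) with d | d
      · have := (ih (g j + 1) (g j' + 1)).2 (hg.second j h) (hg.second j' h') (i - f (2*k)) (by omega)
        rw [u1, v1] at this
        convert this using 2 <;> omega
      · have := (ih (g j + 2) (g j' + 2)).1 (hg.third j h) (hg.third j' h')
          (i - f (2*k) - cc f k) (by omega)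
        rw [u2, v2, u1, v1] at this
        convert this using 2 <;> omega
    · intro h h' i hi
      exact (ih (g j) (g j')).1 (hg.first j) (hg.first j') i hi

theorem right_ext {f : ℕ → ℕ} (hf : IsFSeq f) {s g : ℕ → ℕ} (hg : GoodSeq s g)
    (k : ℕ) : ∀ j j', s j = 1 → s j' = 0 → ∀ i < ee f k,
    s (g^[k] j + i) = s (g^[k] j' + i) := by
  induction k with
  | zero => intro j j' _ _ i hi; simp [ee] at hi
  | succ k ih =>
    intro j j' h h' i hi
    simp only [Function.iterate_succ, Function.comp]
    simp only [ee] at hi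
    rcases lt_or_ge i (f (2*k)) with c | c
    · exact (agree hf hg k (g j) (g j')).1 (hg.first j) (hg.first j') i c
    · have hn : s (g j' + 1) = 1 := by rw [← hg.gz j' h']; exact hg.first _
      have := ih (g j' + 1) (g j + 1) hn (hg.second j h) (i - f (2*k)) (by omega)
      rw [(iter_step hf hg k (g j)).1 (hg.first j), (iter_step hf hg k (g j')).1 (hg.first j')] at this
      rw [eq_comm]
      convert this using 2 <;> omega

theorem prev_one {s g : ℕ → ℕ} (hg : GoodSeq s g)
    (j : ℕ) : ∃ m, g (j+1) = m + 1 ∧ s m = 1 := by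
  rcases hg.bin j with h | h
  · exact ⟨g j, hg.gz j h, hg.first j⟩
  · exact ⟨g j + 2, hg.g1 j h, hg.third j h⟩

theorem left_ext {f : ℕ → ℕ} (hf : IsFSeq f) {s g : ℕ → ℕ} (hg : GoodSeq s g)
    (k : ℕ) : ∀ j j', s j = 1 → s j' = 0 → ∀ x y i, 1 ≤ i → i ≤ ee f k →
    x + i = g^[k] (j+1) → y + i = g^[k] (j'+1) → s x = s y := by
  induction k with
  | zero => intro j j' _ _ x y i h1 hi; simp [ee] at hi; omega
  | succ k ih =>
    intro j j' h h' x y i hi1 hi hx hy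
    simp only [Function.iterate_succ, Function.comp] at hx hy
    simp only [ee] at hi
    rw [hg.g1 j h] at hx
    rw [hg.gz j' h'] at hy
    have u3 := (iter_step hf hg k (g j + 2)).1 (hg.third j h)
    have v1 := (iter_step hf hg k (g j')).1 (hg.first j')
    have u3' : g^[k] (g j + 3) = g^[k] (g j + 2) + f (2*k) := u3
    rcases le_or_gt i (f (2*k)) with c | c
    · have := (agree hf hg k (g j + 2) (g j')).1 (hg.third j h) (hg.first j') (f (2*k) - i) (by omega)
      convert this using 2 <;> omega
    · obtain ⟨p, rfl⟩ : ∃ p, j' = p + 1 := by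
        cases j' with
        | zero => rw [hg.s0] at h'; omega
        | succ p => exact ⟨p, rfl⟩
      obtain ⟨m, hm, hm1⟩ := prev_one hg p
      refine (ih m (g j + 1) hm1 (hg.second j h) y x (i - f (2*k)) (by omega) (by omega) ?_ ?_).symm
      · rw [← hm]; omega
      · have : g j + 1 + 1 = g j + 2 := rfl
        rw [this]; omega

/-- periodicity -/
theorem periodic {f : ℕ → ℕ} (hf : IsFSeq f) {s g : ℕ → ℕ} (hg : GoodSeq s g)
    (k q : ℕ) (h0 : s q = 0) (h1 : s (q+1) = 1) (h2 : s (q+2) = 1) (x : ℕ)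
    (hx : g^[k] (q+1) ≤ x + ee f k) (hx2 : x < g^[k] (q+1) + f (2*k) + ee f k) :
    s x = s (x + f (2*k)) := by
  have u1 : g^[k] (q+2) = g^[k] (q+1) + f (2*k) := (iter_step hf hg k (q+1)).1 h1
  have u2 : g^[k] (q+3) = g^[k] (q+2) + f (2*k) := (iter_step hf hg k (q+2)).1 h2
  have el := ee_le hf k
  rcases lt_or_ge x (g^[k] (q+1)) with c | c
  · exact (left_ext hf hg k (q+1) q h1 h0 (x + f (2*k)) x (g^[k] (q+1) - x) (by omega) (by omega)
      (by show _ = g^[k] (q+2); omega) (by omega)).symm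
  rcases lt_or_ge x (g^[k] (q+1) + f (2*k)) with d | d
  · have := (agree hf hg k (q+1) (q+2)).1 h1 h2 (x - g^[k] (q+1)) (by omega)
    convert this using 2 <;> omega
  · rcases hg.bin (q+3) with h3 | h3
    · have := right_ext hf hg k (q+2) (q+3) h2 h3 (x - g^[k] (q+2)) (by omega)
      convert this using 2 <;> omega
    · have := (agree hf hg k (q+2) (q+3)).1 h2 h3 (x - g^[k] (q+2)) (by omega)
      convert this using 2 <;> omega


theorem H_shift (s : ℕ → ℕ) (m n : ℕ) (hn : n % 2 = 1) (h : ∀ j < n, s (m + j) = s (m + j + n)) :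
    H s (m+1) n = H s m n := by
  obtain ⟨n, rfl⟩ : ∃ n', n = n' + 1 := ⟨n - 1, by omega⟩
  unfold H
  have hd := Matrix.det_permute (finRotate (n+1))
    (Matrix.of fun i j : Fin (n+1) => (s (m + i.1 + j.1) : ℤ))
  rw [sign_finRotate, Even.neg_one_pow (Nat.even_iff.2 (by omega))] at hd
  simp only [Units.val_one, Int.cast_one, one_mul] at hd
  rw [← hd]
  congr 1
  ext i j
  simp only [Matrix.of_apply, Matrix.submatrix_apply, id]
  rcases eq_or_ne i (Fin.last n) with rfl | hi
  · rw [finRotate_last]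
    have := h j.1 j.2
    simp only [Fin.val_last, Fin.val_zero, add_zero]
    rw [this]
    congr 2
    ring
  · rw [coe_finRotate_of_ne_last hi]
    congr 2
    ring

theorem H_const (s : ℕ → ℕ) (n A B : ℕ) (hn : n % 2 = 1)
    (h : ∀ x, A ≤ x → x < B + n → s x = s (x + n)) :
    ∀ d, A + d ≤ B + 1 → H s (A + d) n = H s A n := by
  intro d
  induction d with
  | zero => simp
  | succ d ih =>
    intro hd
    rw [← ih (by omega), ← H_shift s (A+d) n hn]
    · rfl
    · intro j hj
      exact h _ (by omega) (by omega)

theorem H_const' (s : ℕ → ℕ) (n A B x y : ℕ) (hn : n % 2 = 1)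
    (h : ∀ x, A ≤ x → x < B + n → s x = s (x + n)) (hx : A ≤ x) (hx' : x ≤ B + 1)
    (hy : A ≤ y) (hy' : y ≤ B + 1) : H s x n = H s y n := by
  have a := H_const s n A B hn h (x - A) (by omega)
  have b := H_const s n A B hn h (y - A) (by omega)
  rw [Nat.add_sub_cancel' hx] at a
  rw [Nat.add_sub_cancel' hy] at b
  rw [a, b]


theorem H_base {f : ℕ → ℕ} (hf : IsFSeq f) {s g : ℕ → ℕ} (hg : GoodSeq s g)
    (k q q' : ℕ) (h1 : s q = 1) (h2 : s (q+1) = 1) (h1' : s q' = 1) (h2' : s (q'+1) = 1) :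
    H s (g^[k] q) (f (2*k)) = H s (g^[k] q') (f (2*k)) := by
  have key : ∀ i < 2 * f (2*k), s (g^[k] q + i) = s (g^[k] q' + i) := by
    intro i hi
    rcases lt_or_ge i (f (2*k)) with c | c
    · exact (agree hf hg k q q').1 h1 h1' i c
    · have := (agree hf hg k (q+1) (q'+1)).1 h2 h2' (i - f (2*k)) (by omega)
      rw [(iter_step hf hg k q).1 h1, (iter_step hf hg k q').1 h1'] at this
      convert this using 2 <;> omega
  unfold H
  congr 1
  ext i j
  have := key (i.1 + j.1) (by omega)
  simp only [Matrix.of_apply, add_assoc, this]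

theorem U_edge {f : ℕ → ℕ} (hf : IsFSeq f) {s g : ℕ → ℕ} (hg : GoodSeq s g)
    (k q x : ℕ) (h0 : s q = 0) (h1 : s (q+1) = 1) (h2 : s (q+2) = 1)
    (hx : g^[k] (q+1) ≤ x + ee f k) (hx2 : x ≤ g^[k] (q+1) + ee f k + 1) :
    H s x (f (2*k)) = H s (g^[k] (q+1)) (f (2*k)) := by
  refine H_const' s _ (g^[k] (q+1) - ee f k) (g^[k] (q+1) + ee f k) _ _ (f_odd hf k) ?_
    (by omega) (by omega) (by omega) (by omega)
  intro y hy hy'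
  exact periodic hf hg k q h0 h1 h2 y (by omega) (by omega)

theorem V_edge {f : ℕ → ℕ} (hf : IsFSeq f) {s g : ℕ → ℕ} (hg : GoodSeq s g)
    (k q x : ℕ) (h0 : s q = 0) (h1 : s (q+1) = 1) (h2 : s (q+2) = 1)
    (h3 : s (q+3) = 1) (h4 : s (q+4) = 0)
    (hx : g^[k] (q+1) ≤ x + ee f k) (hx2 : x ≤ g^[k] (q+1) + f (2*k) + ee f k + 1) :
    H s x (f (2*k)) = H s (g^[k] (q+1)) (f (2*k)) := by
  refine H_const' s _ (g^[k] (q+1) - ee f k) (g^[k] (q+1) + f (2*k) + ee f k) _ _ (f_odd hf k) ?_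
    (by omega) (by omega) (by omega) (by omega)
  intro y hy hy'
  have u1 : g^[k] (q+2) = g^[k] (q+1) + f (2*k) := (iter_step hf hg k (q+1)).1 h1
  have u2 : g^[k] (q+3) = g^[k] (q+2) + f (2*k) := (iter_step hf hg k (q+2)).1 h2
  have u3 : g^[k] (q+4) = g^[k] (q+3) + f (2*k) := (iter_step hf hg k (q+3)).1 h3
  have el := ee_le hf k
  rcases lt_or_ge y (g^[k] (q+2)) with c | c
  · exact periodic hf hg k q h0 h1 h2 y (by omega) (by omega)
  rcases lt_or_ge y (g^[k] (q+3)) with d | d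
  · have := (agree hf hg k (q+2) (q+3)).1 h2 h3 (y - g^[k] (q+2)) (by omega)
    convert this using 2 <;> omega
  · have := right_ext hf hg k (q+3) (q+4) h3 h4 (y - g^[k] (q+3)) (by omega)
    convert this using 2 <;> omega

/-- Dumont–Thomas: the upper part of the f-representation is a block position. -/
theorem dumont {f : ℕ → ℕ} (hf : IsFSeq f) {s g : ℕ → ℕ} (hg : GoodSeq s g)
    (a : ℕ → ℕ) (h01 : ∀ i, a i ≤ 1) (hA : ∀ i, a i * a (i+1) = 0)
    (hB : ∀ i, Even i → a i * a (i+2) = 0) (M : ℕ) (hM : ∀ i, 2*M ≤ i → a i = 0) :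
    ∀ d k, k + d = M → ∃ j, g^[k] j = ∑ i ∈ Finset.Ico (2*k) (2*M), a i * f i ∧
      (a (2*k) = 0 → s j = 1) ∧ (a (2*k) = 1 → s j = 0) ∧
      (a (2*k) = 0 → a (2*k+1) = 1 ∨ a (2*k+2) = 1 → s (j+1) = 1) := by
  intro d
  induction d with
  | zero =>
    intro k hk
    obtain rfl : k = M := by omega
    refine ⟨0, ?_, fun _ => hg.s0, ?_, ?_⟩
    · rw [Finset.Ico_self, Finset.sum_empty]
      exact Function.iterate_fixed hg.g0 k
    · intro h; rw [hM _ le_rfl] at h; omega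
    · rw [hM (2*k+1) (by omega), hM (2*k+2) (by omega)]; intro _ h; omega
  | succ d ih =>
    intro k hk
    obtain ⟨j, hj, hj0, hj1, -⟩ := ih (k+1) (by omega)
    rw [Function.iterate_succ, Function.comp] at hj
    have e : 2*(k+1) = 2*k+2 := by ring
    rw [e] at hj hj0 hj1
    rw [Finset.sum_eq_sum_Ico_succ_bot (by omega), Finset.sum_eq_sum_Ico_succ_bot (by omega),
      show 2*k+1+1 = 2*k+2 from rfl, ← hj]
    have p1 := hA (2*k)
    have p2 := hA (2*k+1)
    have p3 := hB (2*k) ⟨k, by ring⟩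
    rw [show 2*k+1+1 = 2*k+2 from rfl] at p2
    have u1 := (iter_step hf hg k (g j)).1 (hg.first j)
    have c0 := h01 (2*k)
    have c1 := h01 (2*k+1)
    have c2 := h01 (2*k+2)
    have fc := f_cc hf k
    rcases Nat.le_one_iff_eq_zero_or_eq_one.1 c2 with z2 | z2
    · have sj := hj0 z2
      have u2 := (iter_step hf hg k (g j + 1)).2 (hg.second j sj)
      have u2' : g^[k] (g j + 2) = g^[k] (g j + 1) + cc f k := u2
      rcases Nat.le_one_iff_eq_zero_or_eq_one.1 c1 with z1 | z1
      · rcases Nat.le_one_iff_eq_zero_or_eq_one.1 c0 with z0 | z0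
        · refine ⟨g j, by simp [z0, z1], fun _ => hg.first j, by omega, ?_⟩
          rw [z1, z2]; omega
        · refine ⟨g j + 1, by rw [u1, z0, z1]; ring, by omega, fun _ => hg.second j sj, by omega⟩
      · have z0 : a (2*k) = 0 := by simpa [z1] using p1
        refine ⟨g j + 2, by rw [u2', u1, z0, z1, fc]; ring, fun _ => hg.third j sj, by omega, ?_⟩
        intro _ _
        have := hg.g1 j sj
        rw [show g j + 2 + 1 = g j + 3 from rfl, ← this]
        exact hg.first _
    · have z1 : a (2*k+1) = 0 := by simpa [z2] using p2
      have z0 : a (2*k) = 0 := by simpa [z2] using p3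
      have sj := hj1 z2
      refine ⟨g j, by simp [z0, z1], fun _ => hg.first j, by omega, ?_⟩
      intro _ _
      rw [← hg.gz j sj]
      exact hg.first _

theorem rep_pos {f : ℕ → ℕ} (hf : IsFSeq f) {s g : ℕ → ℕ} (hg : GoodSeq s g)
    (n : ℕ) (a : ℕ → ℕ) (ha : IsFRep f n a) (k : ℕ) :
    ∃ j, n = (∑ i ∈ Finset.range (2*k), a i * f i) + g^[k] j ∧
      (a (2*k) = 0 → s j = 1) ∧
      (a (2*k) = 0 → a (2*k+1) = 1 ∨ a (2*k+2) = 1 → s (j+1) = 1) := by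
  obtain ⟨h01, hA, hB, N, hN, hn⟩ := ha
  obtain ⟨j, hj, h0, -, h2⟩ := dumont hf hg a h01 hA hB (k+N) (fun i hi => hN i (by omega)) N k rfl
  refine ⟨j, ?_, h0, h2⟩
  rw [hj, Finset.sum_range_add_sum_Ico _ (by omega), hn]
  refine Finset.sum_subset (Finset.range_mono (by omega)) ?_
  intro i _ hi
  rw [hN i (by simpa using hi), zero_mul]


theorem bottom_edges_UV (f : ℕ → ℕ) (hf : IsFSeq f) (s : ℕ → ℕ) (hs : IsFixedSeq s) (a : ℕ → ℕ → ℕ) (ha : ∀ n, IsFRep f n (a n)) :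
    ∀ k β' r α r' : ℕ,
      Phi f a k β' = f (2*k+1) / 2 → Phi f a (k+1) β' ≠ f (2*k+1) / 2 →
      1 ≤ r → r ≤ f (2*k+1) →
      Phi f a (k+1) α = f (2*k+5) / 2 →
      1 ≤ r' → r' ≤ f (2*k+2) →
      H s (β' + r) (f (2*k)) = H s (f (2*k+5) / 2 - f (2*k)) (f (2*k)) ∧
      H s (α - f (2*k+3) + r') (f (2*k)) = H s (f (2*k+5) / 2 - f (2*k)) (f (2*k)) := by
  intro k β' r α r' hb hb' hr hr2 hα hr' hr2'
  have hg := good_of_fixed s hs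
  generalize gpos s = g at hg
  have F1 := f_ee hf k
  have F2 := hf.2.2.1 k
  have F3 := hf.2.2.2 k
  have F4 : f (2*k+4) = f (2*k+2) + f (2*k+3) := hf.2.2.1 (k+1)
  have F5 : f (2*k+5) = f (2*k+2) + f (2*k+4) := hf.2.2.2 (k+1)
  have fc := f_cc hf k
  have el := ee_le hf k
  -- any level-(k+2) letter one gives a V-block
  have V : ∀ j x, s j = 1 → g^[k+2] j + ee f k + 2 ≤ x →
      x ≤ g^[k+2] j + f (2*k+2) + ee f k + 1 → H s x (f (2*k)) = H s (g^[k] 2) (f (2*k)) := by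
    intro j x hj hx hx2
    have i1 := hg.first j
    have i2 := hg.second j hj
    have i3 := hg.third j hj
    have G1 := hg.g1 (g j) i1
    have G2 := hg.gz (g j + 1) i2
    rw [show g j + 1 + 1 = g j + 2 from rfl] at G2
    set q := g (g j) with hq
    have w1 : s q = 1 := hg.first _
    have w2 : s (q+1) = 0 := hg.second _ i1
    have w3 : s (q+2) = 1 := hg.third _ i1
    have w4 : s (q+3) = 1 := by rw [← G1]; exact hg.first _
    have w5 : s (q+4) = 1 := by
      rw [show q + 4 = g (g j + 2) by omega]; exact hg.first _
    have w6 : s (q+5) = 0 := by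
      rw [show q + 5 = g (g j + 2) + 1 by omega]; exact hg.second _ i3
    have P1 := (iter_step hf hg k q).1 w1
    have P2 : g^[k] (q+2) = g^[k] (q+1) + cc f k := (iter_step hf hg k (q+1)).2 w2
    have P0 : g^[k+2] j = g^[k] q := rfl
    rw [V_edge hf hg k (q+1) x w2 w3 w4 w5 w6 (by show g^[k] (q+2) ≤ _; omega)
      (by show _ ≤ g^[k] (q+2) + _ + _ + _; omega)]
    have g00 := hg.g0
    have t1 := hg.g1 0 hg.s0
    have t2 := hg.third 0 hg.s0
    have t3 := hg.first 1
    rw [g00] at t1 t2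
    rw [t1] at t3
    exact H_base hf hg k (q+2) 2 w3 w4 t2 t3
  have R : H s (f (2*k+5) / 2 - f (2*k)) (f (2*k)) = H s (g^[k] 2) (f (2*k)) := by
    have : g^[k+2] 0 = 0 := Function.iterate_fixed hg.g0 _
    exact V 0 _ hg.s0 (by omega) (by omega)
  rw [R]
  constructor
  · have h01 := (ha β').1
    unfold Phi at hb hb'
    obtain ⟨j, hn, hj1, hj2⟩ := rep_pos hf hg β' (a β') (ha β') (k+1)
    rw [show 2*(k+1) = 2*k+2 by ring] at hn hj1 hj2
    rw [show 2*(k+1)+3 = 2*k+3+1+1 by ring, Finset.sum_range_succ, Finset.sum_range_succ, hb] at hb'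
    rw [Finset.sum_range_succ] at hb
    have z : a β' (2*k+2) = 0 := by
      rcases Nat.le_one_iff_eq_zero_or_eq_one.1 (h01 (2*k+2)) with h | h
      · exact h
      · rw [h] at hb; omega
    rw [z] at hb
    have sj := hj1 z
    have sj2 : s (j+1) = 1 := by
      apply hj2 z
      by_contra hc
      push Not at hc
      have x1 : a β' (2*k+3) ≠ 1 := hc.1
      have x2 : a β' (2*k+3+1) ≠ 1 := hc.2
      have y1 := h01 (2*k+3)
      have y2 := h01 (2*k+3+1)
      have e1 : a β' (2*k+3) = 0 := by clear hb'; omega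
      have e2 : a β' (2*k+3+1) = 0 := by clear hb'; omega
      rw [e1, e2] at hb'
      omega
    have w1 := hg.first j
    have w2 := hg.second j sj
    have w3 := hg.third j sj
    have G1 := hg.g1 j sj
    have w4 : s (g j + 3) = 1 := by rw [← G1]; exact hg.first _
    have P1 := (iter_step hf hg k (g j)).1 w1
    have P2 : g^[k] (g j+2) = g^[k] (g j+1) + cc f k := (iter_step hf hg k (g j+1)).2 w2
    have P0 : g^[k+1] j = g^[k] (g j) := rfl
    rw [U_edge hf hg k (g j + 1) (β' + r) w2 w3 w4 (by show g^[k] (g j+2) ≤ _; omega)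
      (by show _ ≤ g^[k] (g j+2) + _ + _; omega)]
    have g00 := hg.g0
    have t1 := hg.g1 0 hg.s0
    have t2 := hg.third 0 hg.s0
    have t3 := hg.first 1
    rw [g00] at t1 t2
    rw [t1] at t3
    exact H_base hf hg k (g j+2) 2 w3 w4 t2 t3
  · have h01 := (ha α).1
    unfold Phi at hα
    obtain ⟨j, hn, hj1, -⟩ := rep_pos hf hg α (a α) (ha α) (k+2)
    rw [show 2*(k+2) = 2*k+4 by ring] at hn hj1
    rw [show 2*(k+1)+3 = 2*k+4+1 by ring, Finset.sum_range_succ] at hα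
    have z : a α (2*k+4) = 0 := by
      rcases Nat.le_one_iff_eq_zero_or_eq_one.1 (h01 (2*k+4)) with h | h
      · exact h
      · rw [h] at hα; omega
    rw [z] at hα
    exact V j _ (hj1 z) (by omega) (by omega)
end

section
/- Let k ≥ 0 and α ∈ E'_{k+1}. For every integer r with 0 ≤ r ≤ f_{2k+2} − 1: (i) H_{α−f_{2k+3}+1+r, f_{2k+3}−1−r} = (−1)^{rk} (−1)^{r(r−1)/2} H_{α−f_{2k+3}+1, f_{2k+3}−1}; (ii) if α − f_{2k+4} + 2 + r ≥ 0, then H_{α−f_{2k+4}+2+r, f_{2k+3}−1−r} = (−1)^{rk} (−1)^{r(r−1)/2} H_{α−f_{2k+3}+1, f_{2k+3}−1}; (iii) if α − f_{2k+4} + 2 + r ≥ 0, then H_{α−f_{2k+4}+2+r, f_{2k+3}−1} = (−1)^r H_{α−f_{2k+3}+1, f_{2k+3}−1}. -/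
/-- Hankel determinant of an integer-indexed sequence. -/
def HZ (X : ℤ → ℤ) (m : ℤ) (n : ℕ) : ℤ :=
  (Matrix.of fun i j : Fin n => X (m + (i.1 : ℤ) + (j.1 : ℤ))).det

/-- Indicator of divisibility. -/
def dv (A : ℕ) (i : ℤ) : ℤ := if (A : ℤ) ∣ i then 1 else 0

/-- Abstract properties of the periodic word. -/
structure Good (X : ℤ → ℤ) (A B C : ℕ) (e : ℤ) : Prop where
  hA : A = B + C
  hC : 1 ≤ C
  hCB : C < B
  ev : Even A
  he : e * e = 1
  per : ∀ i, X (i + A) = X i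
  dif : ∀ i, X (i + B) - X i = e * (dv A (i + 3) - dv A (i + 2))
  nn : ∀ i, 0 ≤ X i
  ex : ∃ i, 0 < X i ∧ ¬ (A : ℤ) ∣ i - B + 2

lemma dv_per (A : ℕ) (i : ℤ) : dv A (i + A) = dv A i := by
  unfold dv; simp

lemma dv_per' (A : ℕ) (i : ℤ) : dv A (i - A) = dv A i := by
  have := dv_per A (i - A); rw [sub_add_cancel] at this; exact this.symm

lemma dv_zero_of_lt (A : ℕ) (i : ℤ) (h0 : 0 < i) (h1 : i < A) : dv A i = 0 := by
  unfold dv; rw [if_neg]; intro h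
  have := Int.le_of_dvd h0 h; omega

lemma dv_zero_of_lt2 (A : ℕ) (i : ℤ) (h0 : (A : ℤ) < i) (h1 : i < 2 * A) : dv A i = 0 := by
  rw [← dv_per']; apply dv_zero_of_lt <;> omega

lemma const_of_step (g : ℤ → ℤ) (h : ∀ i, g (i + 1) = g i) (i : ℤ) : g i = g 0 := by
  induction i using Int.induction_on with
  | zero => rfl
  | succ n ih => rw [h, ih]
  | pred n ih => rw [← ih, ← h (-(n : ℤ) - 1)]; congr 1; ring

lemma sum_step (X : ℤ → ℤ) (n : ℕ) (i : ℤ) :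
    ∑ t ∈ Finset.range n, X (i + 1 + t) = ∑ t ∈ Finset.range n, X (i + t) + X (i + n) - X i := by
  have h1 := Finset.sum_range_succ (fun t : ℕ => X (i + t)) n
  have h2 := Finset.sum_range_succ' (fun t : ℕ => X (i + t)) n
  have h3 : ∑ t ∈ Finset.range n, X (i + 1 + t) = ∑ t ∈ Finset.range n, X (i + ((t + 1 : ℕ) : ℤ)) := by
    apply Finset.sum_congr rfl; intro t _; congr 1; push_cast; ring
  rw [h3]; simp only [Nat.cast_zero, add_zero] at h2
  linarith

namespace Good
variable {X : ℤ → ℤ} {A B C : ℕ} {e : ℤ}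

lemma difC (g : Good X A B C e) (i : ℤ) :
    X (i + C) - X i = - (e * (dv A (i - B + 3) - dv A (i - B + 2))) := by
  have h1 := g.dif (i - B)
  have h2 := g.per (i - B)
  have hA := g.hA
  rw [show i - B + A = i + C by rw [hA]; push_cast; ring] at h2
  rw [sub_add_cancel] at h1
  rw [h2, ← h1]; ring

lemma sumB (g : Good X A B C e) :
    ∃ Q, ∀ i, ∑ t ∈ Finset.range B, X (i + t) = Q + e * dv A (i + 2) := by
  refine ⟨_, fun i => eq_add_of_sub_eq
    (const_of_step (fun i => ∑ t ∈ Finset.range B, X (i + t) - e * dv A (i + 2)) ?_ i)⟩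
  intro i
  have := g.dif i
  simp only [sum_step]
  rw [show i + 1 + 2 = i + 3 by ring]
  linarith

lemma sumC (g : Good X A B C e) :
    ∃ R, R ≠ 0 ∧ ∀ i, ∑ t ∈ Finset.range C, X (i + t) = R - e * dv A (i - B + 2) := by
  have key : ∃ R, ∀ i, ∑ t ∈ Finset.range C, X (i + t) = R - e * dv A (i - B + 2) := by
    refine ⟨_, fun i => eq_sub_of_add_eq
      (const_of_step (fun i => ∑ t ∈ Finset.range C, X (i + t) + e * dv A (i - B + 2)) ?_ i)⟩
    intro i
    have := g.difC i
    simp only [sum_step]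
    rw [show i + 1 - B + 2 = i - B + 3 by ring]
    linarith
  obtain ⟨R, hR⟩ := key
  refine ⟨R, ?_, hR⟩
  obtain ⟨i, hi, hd⟩ := g.ex
  have h := hR i
  have hz : dv A (i - B + 2) = 0 := by unfold dv; rw [if_neg hd]
  rw [hz] at h
  have h2 : X (i + (0 : ℕ)) ≤ ∑ t ∈ Finset.range C, X (i + t) :=
    Finset.single_le_sum (f := fun t : ℕ => X (i + t)) (fun t _ => g.nn _)
      (Finset.mem_range.2 g.hC)
  simp at h2
  intro h0
  rw [h0] at h; linarith

lemma sumA (g : Good X A B C e) :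
    ∃ P, ∀ i, ∑ t ∈ Finset.range A, X (i + t) = P := by
  refine ⟨_, fun i => const_of_step (fun i => ∑ t ∈ Finset.range A, X (i + t)) ?_ i⟩
  intro i
  have := g.per i
  simp only [sum_step]
  linarith

end Good

/-- the functional -/
def ell {n : ℕ} (M : Matrix (Fin (n+1)) (Fin (n+1)) ℤ) (w : ℕ → ℤ) : ℤ :=
  ∑ i : Fin (n+1), M.adjugate 0 i * w i.1

lemma ell_sum {n : ℕ} (M : Matrix (Fin (n+1)) (Fin (n+1)) ℤ) (S : Finset ℕ) (w : ℕ → ℕ → ℤ) :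
    ell M (fun i => ∑ t ∈ S, w t i) = ∑ t ∈ S, ell M (w t) := by
  unfold ell
  rw [Finset.sum_comm]
  apply Finset.sum_congr rfl; intro i _; rw [Finset.mul_sum]

lemma ell_congr {n : ℕ} (M : Matrix (Fin (n+1)) (Fin (n+1)) ℤ) (w w' : ℕ → ℤ)
    (h : ∀ i, i ≤ n → w i = w' i) : ell M w = ell M w' := by
  unfold ell
  apply Finset.sum_congr rfl; intro i _; rw [h i.1 (by omega)]

lemma ell_const {n : ℕ} (M : Matrix (Fin (n+1)) (Fin (n+1)) ℤ) (c : ℤ) :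
    ell M (fun _ => c) = c * ell M (fun _ => 1) := by
  unfold ell
  rw [Finset.mul_sum]
  apply Finset.sum_congr rfl; intro i _; ring

/-- Hankel matrix. -/
def HM (X : ℤ → ℤ) (m : ℤ) (n : ℕ) : Matrix (Fin n) (Fin n) ℤ :=
  Matrix.of fun i j : Fin n => X (m + (i.1 : ℤ) + (j.1 : ℤ))

lemma ell_col (X : ℤ → ℤ) (m : ℤ) (n : ℕ) (j : ℕ) (hj : j ≤ n) :
    ell (HM X m (n+1)) (fun i => X (m + i + j)) = if j = 0 then HZ X m (n+1) else 0 := by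
  have h := Matrix.adjugate_mul (HM X m (n+1))
  have h2 := congrFun (congrFun h 0) ⟨j, by omega⟩
  rw [Matrix.mul_apply] at h2
  have h3 : ell (HM X m (n+1)) (fun i => X (m + i + j)) =
    ∑ i, (HM X m (n+1)).adjugate 0 i * HM X m (n+1) i ⟨j, by omega⟩ := rfl
  rw [h3, h2]
  rcases Nat.eq_zero_or_pos j with h0 | h0
  · subst h0; simp; rfl
  · rw [if_neg (by omega)]
    have : (0 : Fin (n+1)) ≠ ⟨j, by omega⟩ := by
      intro hh; have := congrArg Fin.val hh; simp at this; omega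
    simp [this]

lemma ell_last (X : ℤ → ℤ) (m : ℤ) (n : ℕ) (w : ℕ → ℤ) (hw : ∀ i, i < n → w i = 0)  :
    ell (HM X m (n+1)) w = w n * ((-1) ^ n * HZ X (m+1) n) := by
  unfold ell
  rw [Fin.sum_univ_castSucc]
  rw [Finset.sum_eq_zero, zero_add]
  · rw [Matrix.adjugate_fin_succ_eq_det_submatrix, mul_comm]
    congr 1
    simp only [Fin.val_last, Fin.val_zero, add_zero]
    congr 1
    unfold HZ
    congr 1
    ext i j
    simp [HM, Matrix.submatrix_apply]
    congr 1; ring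
  · intro i _
    rw [hw _ (by simp)]; simp

lemma ell_next (X : ℤ → ℤ) (m : ℤ) (n : ℕ) :
    ell (HM X m (n+1)) (fun i => X (m + i + (n+1 : ℕ))) = (-1) ^ n * HZ X (m+1) (n+1) := by
  unfold ell HZ
  rw [Matrix.det_succ_column _ (Fin.last n), Finset.mul_sum]
  apply Finset.sum_congr rfl; intro i _
  rw [Matrix.adjugate_fin_succ_eq_det_submatrix]
  have h1 : (HM X m (n+1)).submatrix i.succAbove (Fin.succAbove 0) =
    (Matrix.of fun i j : Fin (n+1) => X (m + 1 + (i.1 : ℤ) + (j.1 : ℤ))).submatrix i.succAbove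
      (Fin.last n).succAbove := by
    ext a b
    simp [HM, Matrix.submatrix_apply]
    congr 1; ring
  rw [h1]
  simp only [Fin.val_last, Fin.val_zero, add_zero, Matrix.of_apply]
  rw [show m + 1 + (i.1 : ℤ) + (n : ℤ) = m + i.1 + ((n + 1 : ℕ) : ℤ) by push_cast; ring]
  have h2 : (-1 : ℤ) ^ n * (-1) ^ n = 1 := by rw [← mul_pow]; simp
  rw [pow_add]
  linear_combination (-(-1 : ℤ) ^ i.1 * X (m + i.1 + ((n + 1 : ℕ) : ℤ)) *
    ((Matrix.of fun i j : Fin (n+1) => X (m + 1 + (i.1 : ℤ) + (j.1 : ℤ))).submatrix i.succAbove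
      (Fin.last n).succAbove).det) * h2

lemma Good.step3 {X : ℤ → ℤ} {A B C : ℕ} {e : ℤ} (g : Good X A B C e) (m : ℕ) (hm : m + 2 ≤ B) :
    HZ X (m + 1) (A - 1) = - HZ X m (A - 1) := by
  obtain ⟨P, hP⟩ := g.sumA
  obtain ⟨R, hR0, hR⟩ := g.sumC
  have hA := g.hA
  have hC := g.hC
  obtain ⟨n, hn⟩ : ∃ n, A = n + 2 := ⟨A - 2, by omega⟩
  have hA1 : A - 1 = n + 1 := by omega
  rw [hA1]
  set M := HM X m (n+1) with hM
  have h1 : ell M (fun _ => 1) = 0 := by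
    have h := ell_sum M (Finset.range C) (fun t i => X (m + i + (B - 1 - m + t : ℕ)))
    rw [Finset.sum_eq_zero] at h
    · rw [ell_congr M _ (fun _ => R), ell_const] at h
      · exact (mul_eq_zero.1 h).resolve_left hR0
      · intro i hi
        have := hR (i + B - 1)
        rw [dv_zero_of_lt _ _ (by omega) (by omega)] at this
        rw [mul_zero, sub_zero] at this
        rw [← this]
        apply Finset.sum_congr rfl; intro t _; congr 1; omega
    · intro t ht
      rw [Finset.mem_range] at ht
      rw [ell_col _ _ _ _ (by omega), if_neg (by omega)]
  have h := ell_sum M (Finset.range A) (fun t i => X (m + i + t))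
  rw [ell_congr M _ (fun _ => P) (fun i _ => hP _), ell_const, h1, mul_zero, hn,
    Finset.sum_range_succ, Finset.sum_range_succ', Finset.sum_eq_zero, ell_next,
    ell_col _ _ _ _ (by omega), if_pos rfl] at h
  · have : Even n := by
      have := g.ev; rw [hn] at this
      simpa [Nat.even_add] using this
    rw [this.neg_one_pow] at h
    linarith
  · intro t ht
    rw [Finset.mem_range] at ht
    rw [ell_col _ _ _ _ (by omega), if_neg (by omega)]

lemma Good.step2 {X : ℤ → ℤ} {A B C : ℕ} {e : ℤ} (g : Good X A B C e) (r : ℕ) (hr : r + 2 ≤ B) :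
    HZ X (r + 1) (A - 1 - (r + 1)) = e * (-1) ^ r * HZ X r (A - 1 - r) := by
  obtain ⟨Q, hQ⟩ := g.sumB
  obtain ⟨R, hR0, hR⟩ := g.sumC
  have hA := g.hA
  have hC := g.hC
  obtain ⟨n, hn⟩ : ∃ n, A = n + 2 + r := ⟨A - 2 - r, by omega⟩
  rw [show A - 1 - (r + 1) = n by omega, show A - 1 - r = n + 1 by omega]
  set M := HM X r (n+1) with hM
  have h1 : ell M (fun _ => 1) = 0 := by
    have h := ell_sum M (Finset.range C) (fun t i => X (r + i + (n + 1 - C + t : ℕ)))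
    rw [Finset.sum_eq_zero] at h
    · rw [ell_congr M _ (fun _ => R), ell_const] at h
      · exact (mul_eq_zero.1 h).resolve_left hR0
      · intro i hi
        have := hR (r + i + (n + 1 - C : ℕ))
        rw [dv_zero_of_lt _ _ (by omega) (by omega)] at this
        rw [mul_zero, sub_zero] at this
        rw [← this]
        apply Finset.sum_congr rfl; intro t _; congr 1; omega
    · intro t ht
      rw [Finset.mem_range] at ht
      rw [ell_col _ _ _ _ (by omega), if_neg (by omega)]
  have hcol : ∀ j, j < B → ell M (fun i => X (r + i + j)) = if j = 0 then HZ X r (n+1) else 0 := by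
    intro j
    induction j using Nat.strong_induction_on with
    | _ j ih =>
      intro hj
      by_cases hjn : j ≤ n
      · exact ell_col _ _ _ _ hjn
      · have := ih (j - C) (by omega) (by omega)
        rw [if_neg (by omega)] at this
        rw [if_neg (by omega), ← this]
        apply ell_congr
        intro i hi
        have h := g.difC (r + i + (j - C : ℕ))
        rw [dv_zero_of_lt _ _ (by omega) (by omega), dv_zero_of_lt _ _ (by omega) (by omega)] at h
        rw [show (r : ℤ) + i + j = r + i + (j - C : ℕ) + C by omega]
        linarith
  have h := ell_sum M (Finset.range B) (fun t i => X (r + i + t))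
  have hl : ell M (fun i => e * dv A (r + i + 2)) = e * ((-1) ^ n * HZ X (r + 1) n) := by
    rw [ell_last]
    · congr 1
      rw [show (r : ℤ) + n + 2 = A by omega]; simp [dv]
    · intro i hi
      rw [dv_zero_of_lt _ _ (by omega) (by omega), mul_zero]
  have hs : ell M (fun i => ∑ t ∈ Finset.range B, X (r + i + t)) =
      ell M (fun _ => Q) + ell M (fun i => e * dv A (r + i + 2)) := by
    unfold ell
    rw [← Finset.sum_add_distrib]
    apply Finset.sum_congr rfl; intro i _; simp only [hQ]; ring
  rw [hs, ell_const, h1, hl, Finset.sum_congr rfl (fun j hj => hcol j (Finset.mem_range.1 hj)),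
    Finset.sum_ite_eq' (Finset.range B) 0, if_pos (Finset.mem_range.2 (by omega))] at h
  have hp : (-1 : ℤ) ^ n = (-1) ^ r := by
    have := g.ev; rw [hn] at this
    have : Even (n + r) := by
      rw [show n + 2 + r = n + r + 2 by ring] at this
      simpa [Nat.even_add] using this
    rcases Nat.even_or_odd n with h1 | h1
    · have h2 : Even r := by simpa [Nat.even_add, h1] using this
      rw [h1.neg_one_pow, h2.neg_one_pow]
    · have h2 : Odd r := by
        rw [← Nat.not_even_iff_odd] at h1 ⊢
        simpa [Nat.even_add, h1] using this
      rw [h1.neg_one_pow, h2.neg_one_pow]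
  rw [hp] at h
  have h2 : (-1 : ℤ) ^ r * (-1) ^ r = 1 := by rw [← mul_pow]; simp
  have he := g.he
  linear_combination (e * (-1) ^ r) * h - HZ X (r+1) n * ((-1 : ℤ) ^ r * (-1) ^ r) * he - HZ X (r+1) n * h2

lemma Good.iii {X : ℤ → ℤ} {A B C : ℕ} {e : ℤ} (g : Good X A B C e) (r : ℕ) (hr : r + 1 ≤ B) :
    HZ X r (A - 1) = (-1) ^ r * HZ X 0 (A - 1) := by
  induction r with
  | zero => simp
  | succ r ih =>
    push_cast
    rw [g.step3 r (by omega), ih (by omega), pow_succ]; ring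

lemma Good.ii {X : ℤ → ℤ} {A B C : ℕ} {k : ℕ} (g : Good X A B C ((-1) ^ k)) (r : ℕ) (hr : r + 1 ≤ B) :
    HZ X r (A - 1 - r) = (-1) ^ (r * k) * (-1) ^ (r * (r - 1) / 2) * HZ X 0 (A - 1) := by
  induction r with
  | zero => simp
  | succ r ih =>
    push_cast
    rw [g.step2 r (by omega), ih (by omega)]
    have : (r + 1) * (r + 1 - 1) / 2 = r * (r - 1) / 2 + r := by
      rw [← Finset.sum_range_id_mul_two, ← Finset.sum_range_id_mul_two]
      simp [Finset.sum_range_succ]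
    rw [Nat.add_sub_cancel] at this
    rw [this, pow_add, add_mul, pow_add, one_mul]; ring

lemma Good.rev {X : ℤ → ℤ} {A B C : ℕ} {e : ℤ} (g : Good X A B C e)
    (hx : ∃ i, 0 < X i ∧ ¬ (A : ℤ) ∣ i + 3) :
    Good (fun i => X (2 * A + B - 5 - i)) A B C e where
  hA := g.hA
  hC := g.hC
  hCB := g.hCB
  ev := g.ev
  he := g.he
  per i := by
    have := g.per (2 * A + B - 5 - (i + A))
    rw [← this]; congr 1; ring
  dif i := by
    have h := g.dif (2 * A - 5 - i)
    have h1 : dv A (2 * A - 5 - i + 3) = dv A (i + 2) := by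
      unfold dv
      congr 1
      rw [show (2 * A - 5 - i + 3 : ℤ) = A * 2 - (i + 2) by ring]
      rw [dvd_sub_right (dvd_mul_right _ _)]
    have h2 : dv A (2 * A - 5 - i + 2) = dv A (i + 3) := by
      unfold dv
      congr 1
      rw [show (2 * A - 5 - i + 2 : ℤ) = A * 2 - (i + 3) by ring]
      rw [dvd_sub_right (dvd_mul_right _ _)]
    rw [h1, h2] at h
    rw [show (2 * A + B - 5 - (i + B) : ℤ) = 2 * A - 5 - i by ring,
      show (2 * A + B - 5 - i : ℤ) = 2 * A - 5 - i + B by ring]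
    linarith
  nn i := g.nn _
  ex := by
    obtain ⟨i, h1, h2⟩ := hx
    refine ⟨2 * A + B - 5 - i, by simpa using h1, ?_⟩
    rw [show (2 * A + B - 5 - i - B + 2 : ℤ) = A * 2 - (i + 3) by ring, dvd_sub_right (dvd_mul_right _ _)]
    exact h2

lemma HZ_rev (X : ℤ → ℤ) (A B r : ℕ) (hr : r + 1 ≤ A) :
    HZ (fun i => X (2 * A + B - 5 - i)) r (A - 1 - r) = HZ X (B - 1 + r) (A - 1 - r) := by
  unfold HZ
  rw [← Matrix.det_submatrix_equiv_self Fin.revPerm]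
  congr 1
  ext i j
  simp only [Matrix.submatrix_apply, Matrix.of_apply, Fin.revPerm_apply, Fin.val_rev]
  congr 1
  omega

lemma Good.i {X : ℤ → ℤ} {A B C : ℕ} {k : ℕ} (g : Good X A B C ((-1) ^ k))
    (hx : ∃ i, 0 < X i ∧ ¬ (A : ℤ) ∣ i + 3) (r : ℕ) (hr : r + 1 ≤ B) :
    HZ X (B - 1 + r) (A - 1 - r) =
      (-1) ^ (r * k) * (-1) ^ (r * (r - 1) / 2) * HZ X (B - 1) (A - 1) := by
  have hA := g.hA
  have h := (g.rev hx).ii r hr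
  rw [HZ_rev _ _ _ _ (by omega)] at h
  have h0 := HZ_rev X A B 0 (by omega)
  simp only [Nat.cast_zero, add_zero, Nat.sub_zero] at h0
  rw [h, h0]

/-- Apply the substitution to a word. -/
def Tw (w : List ℕ) : List ℕ := (w.map tau).flatten

/-- Iterated substitution. -/
def Tn (n : ℕ) (w : List ℕ) : List ℕ := Tw^[n] w

lemma Tw_append (a b : List ℕ) : Tw (a ++ b) = Tw a ++ Tw b := by simp [Tw]
lemma Tw_nil : Tw [] = [] := rfl
lemma Tw_cons (a : ℕ) (b : List ℕ) : Tw (a :: b) = tau a ++ Tw b := by simp [Tw]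

lemma Tn_append (n : ℕ) (a b : List ℕ) : Tn n (a ++ b) = Tn n a ++ Tn n b := by
  induction n generalizing a b with
  | zero => rfl
  | succ n ih => simp only [Tn, Function.iterate_succ_apply, Tw_append] at *; rw [ih]

lemma Tn_nil (n : ℕ) : Tn n [] = [] := by
  induction n with
  | zero => rfl
  | succ n ih => simpa only [Tn, Function.iterate_succ_apply, Tw_nil] using ih

lemma Tn_succ (n : ℕ) (w : List ℕ) : Tn (n + 1) w = Tn n (Tw w) := by
  simp only [Tn, Function.iterate_succ_apply]

lemma Tn_succ' (n : ℕ) (w : List ℕ) : Tn (n + 1) w = Tw (Tn n w) := by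
  simp only [Tn, Function.iterate_succ_apply']

lemma Tn_add (m n : ℕ) (w : List ℕ) : Tn (m + n) w = Tn m (Tn n w) := by
  simp only [Tn, Function.iterate_add_apply]

lemma tauIter_eq (n : ℕ) : tauIter n = Tn n [1] := by
  induction n with
  | zero => rfl
  | succ n ih => rw [Tn_succ', ← ih]; rfl

lemma Tw_reverse (w : List ℕ) : Tw w.reverse = (Tw w).reverse := by
  induction w with
  | nil => rfl
  | cons a w ih =>
    rw [List.reverse_cons, Tw_append, ih, Tw_cons a w, List.reverse_append]
    congr 1
    unfold Tw tau
    by_cases h : a = 1 <;> simp [h]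

/-- The common prefix of `τ^n(10)` and `τ^n(01)`. -/
def uu : ℕ → List ℕ
  | 0 => []
  | n + 1 => Tw (uu n) ++ [1]

/-- The first letter of the mismatch. -/
def xx (n : ℕ) : ℕ := if Even n then 1 else 0

lemma w_split (n : ℕ) :
    Tn n [1, 0] = uu n ++ [xx n, 1 - xx n] ++ (uu n).reverse ∧
    Tn n [0, 1] = uu n ++ [1 - xx n, xx n] ++ (uu n).reverse := by
  induction n with
  | zero => constructor <;> rfl
  | succ n ih =>
    rw [Tn_succ', Tn_succ', ih.1, ih.2]
    simp only [Tw_append, Tw_reverse, uu, List.reverse_append, xx]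
    by_cases h : Even n
    · have h' : ¬ Even (n + 1) := by simpa [Nat.even_add_one] using h
      simp [h, h', Tw, tau]
    · have h' : Even (n + 1) := by simpa [Nat.even_add_one] using h
      simp [h, h', Tw, tau]

lemma len_f (f : ℕ → ℕ) (hf : IsFSeq f) (n : ℕ) :
    (Tn n [1]).length = f (2 * n) ∧ (Tn n [1, 0]).length = f (2 * n + 1) := by
  obtain ⟨h0, h1, h2, h3⟩ := hf
  induction n with
  | zero => simp [Tn, h0, h1]
  | succ n ih =>
    have e1 : (Tn (n+1) [1]).length = f (2 * (n + 1)) := by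
      rw [Tn_succ, show Tw [1] = [1, 0] ++ [1] by rfl, Tn_append, List.length_append, ih.1, ih.2,
        mul_add, h2]; ring
    refine ⟨e1, ?_⟩
    rw [show [1, 0] = [1] ++ [0] by rfl, Tn_append, List.length_append, e1, Tn_succ n [0],
      show Tw [0] = [1] by rfl, ih.1, show 2 * (n + 1) + 1 = 2 * n + 3 by ring, h3,
      mul_add]; ring

lemma digits (f : ℕ → ℕ) (hf : IsFSeq f) (M : ℕ) : ∀ (b : ℕ → ℕ), (∀ i, b i ≤ 1) →
    (∀ i, b i * b (i+1) = 0) → (∀ i, Even i → b i * b (i+2) = 0) →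
    (∀ i, 2 * M ≤ i → b i = 0) →
    ∃ pre x post, tauIter (M + 1) = pre ++ x :: post ∧ post ≠ [] ∧ (b 0 = 0 → x = 1) ∧
      ∀ t, (Tn t pre).length = ∑ i ∈ Finset.range (2 * M), b i * f (i + 2 * t) := by
  induction M with
  | zero =>
    intro b _ _ _ h
    refine ⟨[], 1, [0, 1], rfl, by simp, fun _ => rfl, fun t => ?_⟩
    simp [Tn_nil]
  | succ M ih =>
    intro b h1 h2 h3 h4
    obtain ⟨pre, x, post, e, hp, hx, hl⟩ := ih (fun i => b (i + 2)) (fun i => h1 _)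
      (fun i => by have := h2 (i + 2); rwa [show i + 2 + 1 = i + 1 + 2 by ring] at this)
      (fun i hi => h3 (i + 2) (by simpa [Nat.even_add] using hi))
      (fun i hi => h4 _ (by omega))
    have hsum : ∀ t, ∑ i ∈ Finset.range (2 * (M + 1)), b i * f (i + 2 * t) =
        (Tn (t + 1) pre).length + b 1 * f (2 * t + 1) + b 0 * f (2 * t) := by
      intro t
      rw [hl, show 2 * (M + 1) = 2 * M + 1 + 1 by ring, Finset.sum_range_succ',
        Finset.sum_range_succ']
      simp only [Nat.zero_add]
      rw [add_comm 1 (2 * t)]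
      congr 2
      apply Finset.sum_congr rfl; intro i _
      rw [show i + 1 + 1 + 2 * t = i + 2 * (t + 1) by ring]
    have ee : tauIter (M + 1 + 1) = Tw pre ++ tau x ++ Tw post := by
      rw [tauIter_eq, Tn_succ', ← tauIter_eq, e, Tw_append, Tw_cons, List.append_assoc]
    have hpost : Tw post ≠ [] := by
      obtain ⟨y, p, rfl⟩ := List.exists_cons_of_ne_nil hp
      rw [Tw_cons]; unfold tau; split_ifs <;> simp
    have b0 := h1 0
    have b1 := h1 1
    by_cases hb0 : b 0 = 0
    · by_cases hb1 : b 1 = 0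
      · have : ∃ q, tau x = 1 :: q := by unfold tau; split_ifs <;> simp
        obtain ⟨q, hq⟩ := this
        refine ⟨Tw pre, 1, q ++ Tw post, ?_, by simp [hpost], fun _ => rfl, ?_⟩
        · rw [ee, hq]; simp
        · intro t; rw [hsum, hb0, hb1, Tn_succ]; simp
      · have hb1' : b 1 = 1 := by omega
        have hb2 : b 2 = 0 := by have := h2 1; rw [hb1'] at this; simpa using this
        have hx1 : x = 1 := hx hb2
        refine ⟨Tw pre ++ [1, 0], 1, Tw post, ?_, hpost, fun _ => rfl, ?_⟩
        · rw [ee, hx1]; simp [tau]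
        · intro t; rw [hsum, hb0, hb1', Tn_append, List.length_append, Tn_succ, (len_f f hf t).2]
          simp
    · have hb0' : b 0 = 1 := by omega
      have hb1 : b 1 = 0 := by have := h2 0; rw [hb0'] at this; simpa using this
      have hb2 : b 2 = 0 := by have := h3 0 (by simp); rw [hb0'] at this; simpa using this
      have hx1 : x = 1 := hx hb2
      refine ⟨Tw pre ++ [1], 0, 1 :: Tw post, ?_, by simp, fun h => absurd h hb0, ?_⟩
      · rw [ee, hx1]; simp [tau]
      · intro t; rw [hsum, hb0', hb1, Tn_append, List.length_append, Tn_succ, (len_f f hf t).1]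
        simp

lemma Tw_start (w : List ℕ) (hw : w ≠ []) : ∃ q, Tw w = 1 :: q := by
  obtain ⟨y, p, rfl⟩ := List.exists_cons_of_ne_nil hw
  rw [Tw_cons]; unfold tau; split_ifs <;> simp

lemma Tw_end (w : List ℕ) (hw : w ≠ []) : ∃ q, Tw w = q ++ [1] := by
  obtain ⟨q, hq⟩ := Tw_start w.reverse (by simpa using hw)
  rw [Tw_reverse, List.reverse_eq_cons_iff] at hq
  exact ⟨_, hq⟩

/-- Numerical facts about `A = f (2k+3)`, `B = f (2k+2)`, `C = f (2k)`, `N = |u| + 1`. -/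
lemma num_facts (f : ℕ → ℕ) (hf : IsFSeq f) (k : ℕ) :
    f (2*k+3) = 2 * ((uu (k+1)).length + 1) ∧ f (2*k+3) = f (2*k+2) + f (2*k) ∧
    f (2*k) < f (2*k+2) ∧ 1 ≤ f (2*k) ∧ f (2*k+4) = f (2*k+3) + f (2*k+2) ∧
    f (2*k+5) = 2 * f (2*k+2) + f (2*k+3) ∧ Odd (f (2*k+2)) := by
  have hl : ∀ n, f (2 * n + 1) = 2 * ((uu n).length + 1) := by
    intro n
    rw [← (len_f f hf n).2, (w_split n).1]; simp; ring
  obtain ⟨h0, h1, h2, h3⟩ := hf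
  have hodd : ∀ n, Odd (f (2 * n)) := by
    intro n
    induction n with
    | zero => simp [h0]
    | succ n ih =>
      rw [mul_add, mul_one, h2, hl]
      exact ih.add_even (even_two_mul _)
  have e1 := hl (k + 1)
  rw [show 2 * (k + 1) + 1 = 2 * k + 3 by ring] at e1
  have e2 := h2 k
  have e3 := h3 k
  have e4 := h2 (k + 1)
  have e5 := h3 (k + 1)
  have e6 := hl k
  have e7 := (hodd k).pos
  have e8 := hodd (k + 1)
  rw [show 2 * (k + 1) + 2 = 2 * k + 4 by ring, show 2 * (k + 1) + 1 = 2 * k + 3 by ring,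
    show 2 * (k + 1) = 2 * k + 2 by ring] at e4
  rw [show 2 * (k + 1) + 3 = 2 * k + 5 by ring, show 2 * (k + 1) + 2 = 2 * k + 4 by ring,
    show 2 * (k + 1) = 2 * k + 2 by ring] at e5
  rw [show 2 * (k + 1) = 2 * k + 2 by ring] at e8
  refine ⟨e1, by omega, by omega, e7, by omega, by omega, e8⟩

/-- The structure of the word around the position `β = α - Φ`. -/
lemma word_at (f : ℕ → ℕ) (hf : IsFSeq f) (a : ℕ → ℕ) (α : ℕ) (ha : IsFRep f α a) (k : ℕ)
    (hP : ∑ i ∈ Finset.range (2*(k+1)+3), a i * f i = f (2*k+5) / 2) :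
    ∃ K β L1 L3, tauIter K = L1 ++ (Tn (k+1) [1,0,1] ++ (uu (k+1) ++ L3)) ∧ L1.length = β ∧
      α = β + f (2*k+5) / 2 ∧ (L1 = [] ∨ ∃ L0, L1 = L0 ++ (uu (k+1)).reverse) := by
  obtain ⟨n1, n2, n3, n4, n5, n6, n7⟩ := num_facts f hf k
  obtain ⟨h1, h2, h3, N, hN, hα⟩ := ha
  have ha4 : a (2*k+4) = 0 := by
    by_contra h
    have h4 : a (2*k+4) = 1 := by have := h1 (2*k+4); omega
    have h5 : a (2*k+4) * f (2*k+4) ≤ ∑ i ∈ Finset.range (2*(k+1)+3), a i * f i :=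
      Finset.single_le_sum (f := fun i => a i * f i) (fun i _ => Nat.zero_le _)
        (Finset.mem_range.2 (by omega))
    rw [h4, hP] at h5
    omega
  obtain ⟨pre, x, post, e, hp, hx, hl⟩ := digits f hf N (fun i => a (i + 2 * (k + 2)))
    (fun i => h1 _)
    (fun i => by have := h2 (i + 2 * (k+2)); rwa [show i + 2 * (k+2) + 1 = i + 1 + 2 * (k + 2) by ring] at this)
    (fun i hi => by
      have := h3 (i + 2 * (k+2)) (by simpa [Nat.even_add] using hi)
      rwa [show i + 2 * (k+2) + 2 = i + 2 + 2 * (k + 2) by ring] at this)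
    (fun i hi => hN _ (by omega))
  have hx1 : x = 1 := hx (by simpa [mul_add] using ha4)
  subst hx1
  have hβ : α = (Tn (k+2) pre).length + f (2*k+5) / 2 := by
    rw [hl, ← hP]
    have e1 : α = ∑ i ∈ Finset.range (2 * (k+2) + 2 * N), a i * f i := by
      rw [hα]
      apply Finset.sum_subset
      · intro i; simp only [Finset.mem_range]; omega
      · intro i _ hi
        rw [Finset.mem_range] at hi
        rw [hN i (by omega), zero_mul]
    rw [e1, Finset.sum_range_add, show 2 * (k+2) = 2 * (k+1) + 2 by ring,
      Finset.sum_range_succ (n := 2*(k+1)+2), show 2 * (k+1) + 2 = 2*k+4 by ring, ha4, zero_mul, add_zero, add_comm]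
    congr 1
    apply Finset.sum_congr rfl; intro i _
    rw [add_comm i]
  obtain ⟨q, hq⟩ := Tw_start post hp
  have hw := w_split (k + 1)
  have lw := (len_f f hf (k+1)).1
  have lw' : (Tn (k+1) [1]).length = f (2*k+2) := by rw [lw]; congr 1
  have hpre : ∃ z, Tn (k+1) [1] = uu (k+1) ++ z := by
    have h := hw.1
    rw [show [1, 0] = [1] ++ [0] by rfl, Tn_append, List.append_assoc] at h
    have p1 : uu (k+1) <+: Tn (k+1) [1] := by
      refine List.prefix_of_prefix_length_le (l₃ := Tn (k+1) [1] ++ Tn (k+1) [0]) ?_ (List.prefix_append _ _) (by omega)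
      rw [h]; exact List.prefix_append _ _
    obtain ⟨z, hz⟩ := p1
    exact ⟨z, hz.symm⟩
  have hsuf : ∃ z, Tn (k+1) [1] = z ++ (uu (k+1)).reverse := by
    have h := hw.2
    rw [show [0, 1] = [0] ++ [1] by rfl, Tn_append] at h
    have p1 : (uu (k+1)).reverse <:+ Tn (k+1) [1] := by
      refine List.suffix_of_suffix_length_le (l₃ := Tn (k+1) [0] ++ Tn (k+1) [1]) ?_ (List.suffix_append _ _)
        (by rw [List.length_reverse]; omega)
      rw [h]; exact List.suffix_append _ _
    obtain ⟨z, hz⟩ := p1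
    exact ⟨z, hz.symm⟩
  obtain ⟨z, hz⟩ := hpre
  obtain ⟨z', hz'⟩ := hsuf
  refine ⟨k + 1 + (1 + (N + 1)), _, Tn (k+2) pre, z ++ Tn (k+1) q, ?_, rfl, hβ, ?_⟩
  · rw [tauIter_eq, Tn_add (k+1), Tn_add 1, ← tauIter_eq, e]
    rw [show Tn 1 (pre ++ 1 :: post) = Tw pre ++ ([1,0,1] ++ ([1] ++ q)) by
      change Tw (pre ++ 1 :: post) = _
      rw [Tw_append, Tw_cons, hq]; rfl]
    rw [Tn_append, Tn_append, Tn_append (k+1) [1] q, Tn_succ (k+1) pre, hz]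
    simp
  · rcases eq_or_ne pre [] with h | h
    · left; rw [h, Tn_nil]
    · right
      obtain ⟨q', hq'⟩ := Tw_end pre h
      refine ⟨Tn (k+1) q' ++ z', ?_⟩
      rw [Tn_succ (k+1) pre, hq', Tn_append, hz']
      simp

/-- The periodic word `τ^n((10)^∞)` on the integers. -/
def ZZ (n : ℕ) (i : ℤ) : ℤ :=
  (((Tn n [1, 0]).getD (i % ((Tn n [1, 0]).length : ℤ)).toNat 0 : ℕ) : ℤ)

lemma ZZ_per (n : ℕ) (i : ℤ) : ZZ n (i + (Tn n [1, 0]).length) = ZZ n i := by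
  unfold ZZ; rw [Int.add_emod_right]

lemma ZZ_lt (n j : ℕ) (hj : j < (Tn n [1, 0]).length) : ZZ n j = ((Tn n [1, 0]).getD j 0 : ℕ) := by
  unfold ZZ
  rw [Int.emod_eq_of_lt (by omega) (by omega), Int.toNat_natCast]

lemma len_split (n : ℕ) :
    (Tn n [1, 0]).length = (Tn n [1]).length + (Tn n [0]).length := by
  rw [show [1, 0] = [1] ++ [0] by rfl, Tn_append, List.length_append]

lemma ZZ_B (n j : ℕ) (hj : j < (Tn n [1, 0]).length) :
    ZZ n (j + (Tn n [1]).length) = ((Tn n [0, 1]).getD j 0 : ℕ) := by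
  have hl := len_split n
  rw [show Tn n [0, 1] = Tn n [0] ++ Tn n [1] by
    rw [show [0, 1] = [0] ++ [1] by rfl, Tn_append]]
  have e : Tn n [1, 0] = Tn n [1] ++ Tn n [0] := by
    rw [show [1, 0] = [1] ++ [0] by rfl, Tn_append]
  by_cases h : j < (Tn n [0]).length
  · have := ZZ_lt n (j + (Tn n [1]).length) (by omega)
    push_cast at this
    rw [this, e, List.getD_append_right _ _ _ _ (by omega), List.getD_append _ _ _ _ h]
    simp
  · have := ZZ_lt n (j - (Tn n [0]).length) (by omega)
    rw [← ZZ_per] at this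
    rw [show (j : ℤ) + (Tn n [1]).length = ((j - (Tn n [0]).length : ℕ) : ℤ) + (Tn n [1, 0]).length by omega]
    rw [this, e, List.getD_append _ _ _ _ (by omega), List.getD_append_right _ _ _ _ (by omega)]

lemma len_u (n : ℕ) : (Tn n [1, 0]).length = 2 * ((uu n).length + 1) := by
  rw [(w_split n).1]; simp; ring

lemma dv_eq (A : ℕ) (i : ℤ) (h0 : -(A : ℤ) < i) (h1 : i < A) : dv A i = if i = 0 then 1 else 0 := by
  by_cases h : i = 0
  · simp [h, dv]
  · rw [if_neg h]
    rcases lt_or_gt_of_ne h with h2 | h2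
    · rw [← dv_per]; exact dv_zero_of_lt _ _ (by omega) (by omega)
    · exact dv_zero_of_lt _ _ h2 h1

lemma xx_eq (n : ℕ) : (((1 - xx n : ℕ) : ℤ) - (xx n : ℤ)) = -(-1) ^ n := by
  unfold xx
  rcases Nat.even_or_odd n with h | h
  · simp [h]
  · have h' : ¬ Even n := by simpa using h
    simp [h', h.neg_one_pow]

lemma ZZ_dif_lt (n j : ℕ) (hj : j < (Tn n [1, 0]).length) :
    ZZ n (j + (Tn n [1]).length) - ZZ n j =
      -(-1) ^ n * (dv (Tn n [1, 0]).length (j - (uu n).length) -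
        dv (Tn n [1, 0]).length (j - (uu n).length - 1)) := by
  have hl := len_u n
  rw [ZZ_B n j hj, ZZ_lt n j hj, dv_eq _ _ (by omega) (by omega), dv_eq _ _ (by omega) (by omega),
    (w_split n).1, (w_split n).2, List.append_assoc, List.append_assoc, ← xx_eq]
  by_cases h1 : j < (uu n).length
  · rw [List.getD_append _ _ _ _ h1, List.getD_append _ _ _ _ h1, if_neg (by omega), if_neg (by omega)]
    ring
  · rw [List.getD_append_right (uu n) _ _ _ (by omega), List.getD_append_right (uu n) _ _ _ (by omega)]
    obtain ⟨t, rfl⟩ : ∃ t, j = (uu n).length + t := ⟨j - (uu n).length, by omega⟩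
    rw [Nat.add_sub_cancel_left]
    rcases t with _ | _ | t
    · simp
    · simp
    · rw [if_neg (by omega), if_neg (by omega)]
      simp

lemma ZZ_dif (n : ℕ) (i : ℤ) :
    ZZ n (i + (Tn n [1]).length) - ZZ n i =
      -(-1) ^ n * (dv (Tn n [1, 0]).length (i - (uu n).length) -
        dv (Tn n [1, 0]).length (i - (uu n).length - 1)) := by
  have hl := len_u n
  have per : ∀ (g : ℤ → ℤ) (A : ℕ), 0 < A → (∀ i, g (i + A) = g i) → ∀ i, g i = g ((i % (A : ℤ)).toNat) := by
    intro g A hA hg i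
    have hp : Function.Periodic g (A : ℤ) := hg
    have h1 := hp.int_mul (i / A) (i % A)
    rw [Int.toNat_of_nonneg (Int.emod_nonneg _ (by omega)), ← h1]
    congr 1
    have := Int.emod_add_mul_ediv i A
    simp only [Int.cast_id]
    linarith
  have h := per (fun i => ZZ n (i + (Tn n [1]).length) - ZZ n i -
      -(-1) ^ n * (dv (Tn n [1, 0]).length (i - (uu n).length) -
        dv (Tn n [1, 0]).length (i - (uu n).length - 1))) (Tn n [1, 0]).length (by omega) (by
      intro i
      have e1 := ZZ_per n i
      have e2 := ZZ_per n (i + (Tn n [1]).length)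
      have e3 := dv_per (Tn n [1, 0]).length (i - (uu n).length)
      have e4 := dv_per (Tn n [1, 0]).length (i - (uu n).length - 1)
      rw [show i + (Tn n [1]).length + (Tn n [1, 0]).length = i + (Tn n [1, 0]).length + (Tn n [1]).length by ring] at e2
      rw [show i - (uu n).length + (Tn n [1, 0]).length = i + (Tn n [1, 0]).length - (uu n).length by ring] at e3
      rw [show i - (uu n).length - 1 + (Tn n [1, 0]).length = i + (Tn n [1, 0]).length - (uu n).length - 1 by ring] at e4
      rw [e1, e2, e3, e4]) i
  have hlt : (i % ((Tn n [1, 0]).length : ℤ)).toNat < (Tn n [1, 0]).length := by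
    have := Int.emod_lt_of_pos i (b := ((Tn n [1, 0]).length : ℤ)) (by omega)
    have := Int.emod_nonneg i (b := ((Tn n [1, 0]).length : ℤ)) (by omega)
    omega
  rw [ZZ_dif_lt n _ hlt, sub_self] at h
  linarith

lemma ZZ_zero (n : ℕ) : ZZ n 0 = 1 := by
  have hl := len_u n
  have h := ZZ_lt n 0 (by omega)
  have h2 : ∃ q, Tn n [1, 0] = 1 :: q := by
    rcases n with _ | n
    · exact ⟨_, rfl⟩
    · rw [Tn_succ']
      apply Tw_start
      intro h0
      have := len_u n
      rw [h0] at this; simp at this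
  obtain ⟨q, hq⟩ := h2
  rw [hq] at h
  simpa using h

/-- The centred periodic word. -/
def XX (k : ℕ) (i : ℤ) : ℤ := ZZ (k+1) (i + 1 - (uu (k+1)).length)

lemma XX_good (f : ℕ → ℕ) (hf : IsFSeq f) (k : ℕ) :
    Good (XX k) (f (2*k+3)) (f (2*k+2)) (f (2*k)) ((-1) ^ k) ∧
      ∃ i, 0 < XX k i ∧ ¬ ((f (2*k+3) : ℕ) : ℤ) ∣ i + 3 := by
  obtain ⟨n1, n2, n3, n4, n5, n6, n7⟩ := num_facts f hf k
  have lA : (Tn (k+1) [1, 0]).length = f (2*k+3) := (len_f f hf (k+1)).2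
  have lB : (Tn (k+1) [1]).length = f (2*k+2) := (len_f f hf (k+1)).1
  have hz : XX k ((uu (k+1)).length - 1) = 1 := by
    unfold XX; rw [← ZZ_zero (k+1)]; congr 1; ring
  have nd : ∀ i : ℤ, 0 < i → i < f (2*k+3) → ¬ ((f (2*k+3) : ℕ) : ℤ) ∣ i := by
    intro i h0 h1 h
    have := Int.le_of_dvd h0 h; omega
  refine ⟨?_, (uu (k+1)).length - 1, by rw [hz]; norm_num, ?_⟩
  · refine ⟨n2, n4, n3, by rw [n1]; exact even_two_mul _, by rw [← mul_pow]; simp, ?_, ?_, ?_, ?_⟩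
    · intro i
      unfold XX
      rw [← lA, ← ZZ_per (k+1) (i + 1 - _)]
      congr 1; ring
    · intro i
      have h := ZZ_dif (k+1) (i + 1 - (uu (k+1)).length)
      rw [lA, lB] at h
      unfold XX
      rw [show i + f (2*k+2) + 1 - ((uu (k+1)).length : ℤ) = i + 1 - (uu (k+1)).length + f (2*k+2) by ring, h]
      rw [show i + 1 - ((uu (k+1)).length : ℤ) - (uu (k+1)).length = i + 3 - f (2*k+3) by
          rw [n1]; push_cast; ring,
        show i + 3 - (f (2*k+3) : ℤ) - 1 = i + 2 - f (2*k+3) by ring, dv_per', dv_per', pow_succ]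
      ring
    · intro i; unfold XX ZZ; positivity
    · refine ⟨(uu (k+1)).length - 1, by rw [hz]; norm_num, ?_⟩
      rw [← dvd_neg]
      apply nd <;> omega
  · apply nd
    · omega
    · have : 1 ≤ (uu (k+1)).length := by simp [uu]
      omega

lemma s_window (f : ℕ → ℕ) (hf : IsFSeq f) (s : ℕ → ℕ) (hs : IsFixedSeq s) (k K β : ℕ)
    (L1 L3 : List ℕ)
    (hK : tauIter K = L1 ++ (Tn (k+1) [1,0,1] ++ (uu (k+1) ++ L3))) (hβ : L1.length = β)
    (hL : L1 = [] ∨ ∃ L0, L1 = L0 ++ (uu (k+1)).reverse) (j : ℕ)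
    (h1 : β ≤ j + (uu (k+1)).length)
    (h2 : j < β + f (2*k+3) + f (2*k+2) + (uu (k+1)).length) :
    (s j : ℤ) = ZZ (k+1) ((j : ℤ) - β) := by
  obtain ⟨n1, n2, n3, n4, n5, n6, n7⟩ := num_facts f hf k
  have lA : (Tn (k+1) [1, 0]).length = f (2*k+3) := (len_f f hf (k+1)).2
  have lB : (Tn (k+1) [1]).length = f (2*k+2) := (len_f f hf (k+1)).1
  have e : Tn (k+1) [1, 0, 1] = Tn (k+1) [1, 0] ++ Tn (k+1) [1] := by
    rw [show [1, 0, 1] = [1, 0] ++ [1] by rfl, Tn_append]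
  have e' : Tn (k+1) [1, 0] = Tn (k+1) [1] ++ Tn (k+1) [0] := by
    rw [show [1, 0] = [1] ++ [0] by rfl, Tn_append]
  rw [e, List.append_assoc] at hK
  have hlen : (tauIter K).length = β + (f (2*k+3) + (f (2*k+2) + ((uu (k+1)).length + L3.length))) := by
    rw [hK]; simp only [List.length_append, hβ, lA, lB]
  rw [hs K j (by omega), hK]
  by_cases c1 : j < β
  · rw [List.getD_append _ _ _ _ (by omega)]
    rcases hL with hL | ⟨L0, hL⟩
    · rw [hL] at hβ; simp at hβ; omega
    · have hl0 : L0.length + (uu (k+1)).length = β := by rw [← hβ, hL]; simp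
      rw [hL, List.getD_append_right _ _ _ _ (by omega), ← ZZ_per, lA]
      have := ZZ_lt (k+1) (j + f (2*k+3) - β) (by omega)
      rw [show (j : ℤ) - β + f (2*k+3) = (j + f (2*k+3) - β : ℕ) by omega, this, (w_split (k+1)).1,
        List.getD_append_right _ _ _ _ (by simp; omega)]
      congr 2
      simp; omega
  · obtain ⟨t, rfl⟩ : ∃ t, j = β + t := ⟨j - β, by omega⟩
    rw [List.getD_append_right _ _ _ _ (by omega), hβ, Nat.add_sub_cancel_left,
      show ((β + t : ℕ) : ℤ) - β = t by push_cast; ring]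
    by_cases c2 : t < f (2*k+3)
    · rw [List.getD_append _ _ _ _ (by omega), ZZ_lt _ _ (by omega)]
    · obtain ⟨t, rfl⟩ : ∃ t', t = f (2*k+3) + t' := ⟨t - f (2*k+3), by omega⟩
      rw [List.getD_append_right _ _ _ _ (by omega), lA, Nat.add_sub_cancel_left]
      rw [show ((f (2*k+3) + t : ℕ) : ℤ) = t + (Tn (k+1) [1, 0]).length by rw [lA]; push_cast; ring,
        ZZ_per]
      by_cases c3 : t < f (2*k+2)
      · rw [List.getD_append _ _ _ _ (by omega), ZZ_lt _ _ (by omega), e',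
          List.getD_append _ _ _ _ (by omega)]
      · obtain ⟨t, rfl⟩ : ∃ t', t = f (2*k+2) + t' := ⟨t - f (2*k+2), by omega⟩
        rw [List.getD_append_right _ _ _ _ (by omega), lB, Nat.add_sub_cancel_left,
          List.getD_append _ _ _ _ (by omega)]
        rw [show ((f (2*k+2) + t : ℕ) : ℤ) = t + (Tn (k+1) [1]).length by rw [lB]; push_cast; ring,
          ZZ_B _ _ (by omega), (w_split (k+1)).2, List.append_assoc, List.getD_append _ _ _ _ (by omega)]

theorem boundary_U (f : ℕ → ℕ) (hf : IsFSeq f) (s : ℕ → ℕ) (hs : IsFixedSeq s) (a : ℕ → ℕ → ℕ) (ha : ∀ n, IsFRep f n (a n)) :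
    ∀ k α r : ℕ,
      Phi f a (k+1) α = f (2*k+5) / 2 →
      r ≤ f (2*k+2) - 1 →
      (H s (α - f (2*k+3) + 1 + r) (f (2*k+3) - 1 - r) =
          (-1 : ℤ)^(r*k) * (-1 : ℤ)^(r*(r-1)/2) *
            H s (α - f (2*k+3) + 1) (f (2*k+3) - 1)) ∧
      (f (2*k+4) ≤ α + 2 + r →
        H s (α + 2 + r - f (2*k+4)) (f (2*k+3) - 1 - r) =
          (-1 : ℤ)^(r*k) * (-1 : ℤ)^(r*(r-1)/2) *
            H s (α - f (2*k+3) + 1) (f (2*k+3) - 1)) ∧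
      (f (2*k+4) ≤ α + 2 + r →
        H s (α + 2 + r - f (2*k+4)) (f (2*k+3) - 1) =
          (-1 : ℤ)^r * H s (α - f (2*k+3) + 1) (f (2*k+3) - 1)) := by
  intro k α r hP hr
  obtain ⟨K, β, L1, L3, hK, hβ, hα, hL⟩ := word_at f hf (a α) α (ha α) k hP
  have hw := s_window f hf s hs k K β L1 L3 hK hβ hL
  obtain ⟨n1, n2, n3, n4, n5, n6, n7⟩ := num_facts f hf k
  obtain ⟨g, hx⟩ := XX_good f hf k
  have tr : ∀ (m n : ℕ) (q : ℤ), (m : ℤ) = q + β + 1 - (uu (k+1)).length → 0 ≤ q →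
      q + 2 * n ≤ 2 * f (2*k+3) + f (2*k+2) - 2 →
      H s m n = HZ (XX k) q n := by
    intro m n q hm h0 h1
    unfold H HZ
    congr 1
    ext i j
    simp only [Matrix.of_apply]
    rw [hw (m + i.1 + j.1) (by omega) (by omega)]
    unfold XX
    congr 1
    push_cast
    rw [hm]; ring
  set A := f (2*k+3) with hA
  set B := f (2*k+2) with hB
  have hr' : r + 1 ≤ B := by omega
  have hbase : H s (α - A + 1) (A - 1) = HZ (XX k) (B - 1) (A - 1) := by
    apply tr <;> omega
  have hB0 : HZ (XX k) (B - 1) (A - 1) = HZ (XX k) 0 (A - 1) := by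
    have h := g.iii (B - 1) (by omega)
    have hev : Even (B - 1) := by
      obtain ⟨c, hc⟩ := n7
      exact ⟨c, by omega⟩
    rw [hev.neg_one_pow, one_mul] at h
    rw [← h]; congr 1; omega
  rw [hbase]
  refine ⟨?_, fun h => ?_, fun h => ?_⟩
  · rw [tr _ _ (B - 1 + r) (by omega) (by omega) (by omega)]
    exact g.i hx r hr'
  · rw [tr _ _ r (by omega) (by omega) (by omega), hB0]
    exact g.ii r hr'
  · rw [tr _ _ r (by omega) (by omega) (by omega), hB0]
    exact g.iii r hr'
end

section
/- Let k ≥ 0 and β' ∈ F''_k. For every integer r with 0 ≤ r ≤ f_{2k+1} − 1: (i) H_{β'−f_{2k+1}+2+r, f_{2k+2}−1−r} = (−1)^{rk} (−1)^{r(r+1)/2} H_{β'−f_{2k+1}+2, f_{2k+2}−1}; (ii) H_{β'+1+r, f_{2k+2}−1−r} = (−1)^{rk} (−1)^{r(r+1)/2} H_{β'+1, f_{2k+2}−1}; (iii) H_{β'−f_{2k+1}+2+r, f_{2k+2}−1} = H_{β'+1, f_{2k+2}−1}. -/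
/-! ### Hankel determinants over ℤ -/

/-- Hankel determinant of an integer sequence. -/
def Hz (u : ℕ → ℤ) (m n : ℕ) : ℤ :=
  (Matrix.of fun i j : Fin n => u (m + i.1 + j.1)).det

lemma H_eq_Hz (s : ℕ → ℕ) (m n : ℕ) : H s m n = Hz (fun x => (s x : ℤ)) m n := rfl

lemma stepI (u : ℕ → ℤ) (m N p c : ℕ) (δ : ℤ) (hp : 1 ≤ p) (hc : m + N = c + p) (hm : m ≤ c)
    (h0 : u (c + p) - u c = δ) (h : ∀ j, 1 ≤ j → j ≤ N → u (c + p + j) = u (c + j)) :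
    Hz u m (N+1) = (-1)^N * δ * Hz u (m+1) N := by
  unfold Hz
  set M : Matrix (Fin (N+1)) (Fin (N+1)) ℤ := Matrix.of fun i j => u (m + i.1 + j.1) with hM
  have hne : Fin.last N ≠ (⟨N - p, by omega⟩ : Fin (N+1)) := by
    intro h; have := congrArg Fin.val h; simp at this; omega
  rw [← Matrix.det_updateRow_add_smul_self M hne (-1), Matrix.det_succ_row _ (Fin.last N),
    Finset.sum_eq_single 0]
  · have e1 : m + N + 0 = c + p := by omega
    have e2 : m + (N - p) + 0 = c := by omega
    rw [Matrix.updateRow_self]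
    have : (M (Fin.last N) + (-1:ℤ) • M ⟨N - p, by omega⟩) 0 = δ := by
      simp only [hM, Pi.add_apply, Pi.smul_apply, Matrix.of_apply, Fin.val_last, Fin.val_zero, e1, e2]
      rw [← h0]; simp; ring
    rw [this]
    have e3 : (-1:ℤ) ^ ((Fin.last N).1 + (0 : Fin (N+1)).1) = (-1)^N := by simp
    rw [e3]
    congr 1
    · congr 1
      ext i j
      simp only [Matrix.submatrix_apply, Fin.succAbove_last, Fin.succAbove_zero]
      rw [Matrix.updateRow_ne (Fin.castSucc_lt_last i).ne]
      simp [hM]; congr 1; ring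
  · intro j _ hj
    have hj' : 1 ≤ j.1 := by
      rcases Nat.eq_zero_or_pos j.1 with h | h
      · exact absurd (Fin.ext h) hj
      · exact h
    rw [Matrix.updateRow_self]
    have e1 : m + N + j.1 = c + p + j.1 := by omega
    have e2 : m + (N - p) + j.1 = c + j.1 := by omega
    have : (M (Fin.last N) + (-1:ℤ) • M ⟨N - p, by omega⟩) j = 0 := by
      simp only [hM, Pi.add_apply, Pi.smul_apply, Matrix.of_apply, Fin.val_last, e1, e2]
      rw [h j.1 hj' (by omega)]; simp
    rw [this]; simp
  · simp

lemma stepII (u : ℕ → ℤ) (m N p : ℕ) (δ : ℤ) (hp : 1 ≤ p) (hpN : p ≤ N)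
    (h0 : u (m + p + N) - u (m + N) = δ) (h : ∀ j, j < N → u (m + p + j) = u (m + j)) :
    Hz u m (N+1) = (-1)^N * (-δ) * Hz u (m+1) N := by
  unfold Hz
  set M : Matrix (Fin (N+1)) (Fin (N+1)) ℤ := Matrix.of fun i j => u (m + i.1 + j.1) with hM
  have hne : (0 : Fin (N+1)) ≠ (⟨p, by omega⟩ : Fin (N+1)) := by
    intro h; have := congrArg Fin.val h; simp at this; omega
  rw [← Matrix.det_updateRow_add_smul_self M hne (-1), Matrix.det_succ_row _ 0,
    Finset.sum_eq_single (Fin.last N)]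
  · rw [Matrix.updateRow_self]
    have : (M 0 + (-1:ℤ) • M ⟨p, by omega⟩) (Fin.last N) = -δ := by
      simp only [hM, Pi.add_apply, Pi.smul_apply, Matrix.of_apply, Fin.val_last, Fin.val_zero]
      rw [← h0]; simp; ring
    rw [this]
    congr 1
    · simp
    · congr 1
      ext i j
      simp only [Matrix.submatrix_apply, Fin.succAbove_last, Fin.succAbove_zero]
      rw [Matrix.updateRow_ne (Fin.succ_ne_zero i)]
      simp [hM]; congr 1; ring
  · intro j _ hj
    have hj' : j.1 < N := by
      have := j.2
      rcases Nat.lt_or_ge j.1 N with h | h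
      · exact h
      · exact absurd (Fin.ext (by simp; omega)) hj
    rw [Matrix.updateRow_self]
    have : (M 0 + (-1:ℤ) • M ⟨p, by omega⟩) j = 0 := by
      simp only [hM, Pi.add_apply, Pi.smul_apply, Matrix.of_apply, Fin.val_zero]
      rw [h j.1 hj']; simp
    rw [this]; simp
  · simp

lemma sum_window_const (u : ℕ → ℤ) (a p L : ℕ) (h : ∀ j, j < L → u (a + j + p) = u (a + j)) :
    ∀ j, j ≤ L → ∑ l ∈ Finset.range p, u (a + j + l) = ∑ l ∈ Finset.range p, u (a + l) := by
  intro j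
  induction j with
  | zero => simp
  | succ j ih =>
    intro hj
    rw [← ih (by omega)]
    have h1 := Finset.sum_range_succ (fun l => u (a + j + l)) p
    have h2 := Finset.sum_range_succ' (fun l => u (a + j + l)) p
    have h3 : ∀ l, u (a + j + (l + 1)) = u (a + (j + 1) + l) := fun l => by congr 1; ring
    simp only [h3] at h2
    rw [h1] at h2
    have := h j (by omega)
    simp only [add_zero] at h2
    linarith

/-- shifting lemma: `q = N + 2` is a period, the sums over blocks of length `p` starting at
`g, …, g+N` are constant. -/
lemma stepIII (u : ℕ → ℤ) (m N p g : ℕ) (h w : ℤ) (hN : Odd N) (hh : h ≠ 0)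
    (hg : m + 1 ≤ g) (hg' : g + p ≤ m + N + 1)
    (hw : ∀ j, j ≤ N → ∑ l ∈ Finset.range (N+2), u (m + j + l) = w)
    (hU : ∀ j, j ≤ N → ∑ l ∈ Finset.range p, u (g + j + l) = h) :
    Hz u (m+1) (N+1) = Hz u m (N+1) := by
  set M : Matrix (Fin (N+1)) (Fin (N+1)) ℤ := Matrix.of fun i j => u (m + i.1 + j.1) with hM
  set A : Fin (N+1) → ℤ := fun j => u (m + j.1) with hA
  set B : Fin (N+1) → ℤ := fun j => u (m + (N+1) + j.1) with hB
  have hHm : Hz u m (N+1) = (M.updateRow 0 A).det := by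
    have : M.updateRow 0 A = M := by
      have : A = M 0 := by ext j; simp [hA, hM]
      rw [this, Matrix.updateRow_eq_self]
    rw [this]; rfl
  have hHm1 : Hz u (m+1) (N+1) = - (M.updateRow 0 B).det := by
    have h1 := Matrix.det_permute (finRotate (N+1)) (M.updateRow 0 B)
    rw [sign_finRotate, Nat.add_sub_cancel, Odd.neg_one_pow hN] at h1
    have h2 : Hz u (m+1) (N+1) = ((M.updateRow 0 B).submatrix (finRotate (N+1)) id).det := by
      unfold Hz
      congr 1
      ext i j
      simp only [Matrix.submatrix_apply, id, Matrix.of_apply]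
      rcases Fin.eq_castSucc_or_eq_last i with ⟨i, rfl⟩ | rfl
      · have : finRotate (N+1) i.castSucc = i.succ := by
          rw [finRotate_apply]; exact Fin.coeSucc_eq_succ
        rw [this, Matrix.updateRow_ne (Fin.succ_ne_zero i)]
        simp [hM]; congr 1; ring
      · rw [finRotate_last, Matrix.updateRow_self]
        simp [hB]; congr 1; ring
    rw [h2, h1]; simp
  have hadd := Matrix.det_updateRow_add M 0 A B
  have hz : (M.updateRow 0 (A + B)).det = 0 := by
    rw [← Matrix.exists_vecMul_eq_zero_iff]
    refine ⟨fun i => h - if g ≤ m + i.1 ∧ m + i.1 < g + p then w else 0, ?_, ?_⟩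
    · intro h0
      have := congrFun h0 0
      simp at this
      rw [if_neg (by omega)] at this
      simp at this; exact hh this
    · ext j
      have hj : j.1 ≤ N := by omega
      have e1 := hw j.1 hj
      have e2 := hU j.1 hj
      simp only [Matrix.vecMul, dotProduct, Pi.zero_apply]
      rw [Fin.sum_univ_succ, Matrix.updateRow_self]
      simp only [Matrix.updateRow_ne (Fin.succ_ne_zero _)]
      rw [if_neg (by simp; omega)]
      simp only [hA, hB, hM, Matrix.of_apply, Pi.add_apply, Fin.val_succ]
      rw [Fin.sum_univ_eq_sum_range (fun i => (h - if g ≤ m + (i+1) ∧ m + (i+1) < g + p then w else 0)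
        * u (m + (i+1) + j.1)) N]
      simp only [sub_mul, Finset.sum_sub_distrib, ← Finset.mul_sum]
      have e3 : ∑ i ∈ Finset.range N, (if g ≤ m + (i+1) ∧ m + (i+1) < g + p then w else 0)
          * u (m + (i+1) + j.1) = w * h := by
        simp only [ite_mul, zero_mul]
        rw [← Finset.sum_filter, ← e2, Finset.mul_sum]
        symm
        refine Finset.sum_bij (fun l _ => g + l - (m+1)) ?_ ?_ ?_ ?_
        · intro l hl; simp at hl ⊢; omega
        · intro l hl l' hl' hll
          have hll' : g + l - (m+1) = g + l' - (m+1) := hll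
          omega
        · intro i hi; simp at hi
          exact ⟨m + 1 + i - g, Finset.mem_range.2 (by omega), by omega⟩
        · intro l _; congr 2; omega
      rw [e3]
      rw [Finset.sum_range_succ, Finset.sum_range_succ'] at e1
      have e4 : ∀ i, u (m + (i+1) + j.1) = u (m + j.1 + (i+1)) := fun i => by congr 1; ring
      simp only [e4]
      simp only [add_zero] at e1
      rw [← e1]; ring
  rw [hHm, hHm1]
  linarith

/-! ### Block structure of the fixed point -/

lemma tauIter_rec (n : ℕ) : tauIter (n+2) = tauIter (n+1) ++ tauIter n ++ tauIter (n+1) := by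
  induction n with
  | zero => simp [tauIter, tau]
  | succ n ih =>
    have e : ∀ m, tauIter (m+1) = ((tauIter m).map tau).flatten := fun m => rfl
    rw [e (n+2), ih, List.map_append, List.map_append, List.flatten_append, List.flatten_append,
      ← e, ← e, ← ih]

/-- structural data: `p k = f (2k)`, `P k = f (2k+1) / 2`. -/
structure Blk (u : ℕ → ℤ) (p P : ℕ → ℕ) : Prop where
  p0 : p 0 = 1
  P0 : P 0 = 1
  pS : ∀ k, p (k+1) = p k + 2 * P k
  PS : ∀ k, P (k+1) = p k + P k
  u0 : u 0 = 1
  u1 : u 1 = 0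
  nn : ∀ j, 0 ≤ u j
  ha : ∀ k j, j < p k → u (2 * P k + j) = u j
  hb : ∀ k j, j < p k → u (p (k+1) + j) = u j

lemma f_half (f : ℕ → ℕ) (hf : IsFSeq f) (k : ℕ) : f (2*k+1) = 2 * (f (2*k+1) / 2) ∧
    f (2*k+3) / 2 = f (2*k) + f (2*k+1) / 2 := by
  obtain ⟨h0, h1, h2, h3⟩ := hf
  have key : ∀ k, f (2*k+1) = 2 * (f (2*k+1) / 2) := by
    intro k
    induction k with
    | zero => simp [h1]
    | succ k ih =>
      have e : 2*(k+1)+1 = 2*k+3 := by ring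
      rw [e, h3, h2]; omega
  refine ⟨key k, ?_⟩
  have := key k
  rw [h3, h2]; omega

lemma tauIter_length (f : ℕ → ℕ) (hf : IsFSeq f) : ∀ n, (tauIter n).length = f (2*n) ∧
    (tauIter (n+1)).length = f (2*(n+1)) := by
  obtain ⟨h0, h1, h2, h3⟩ := hf
  intro n
  induction n with
  | zero => simp [tauIter, tau, h0]; rw [h2 0]; simp [h0, h1]
  | succ n ih =>
    refine ⟨ih.2, ?_⟩
    rw [tauIter_rec]
    simp only [List.length_append, ih.1, ih.2]
    have a1 := h2 (n+1)
    have a2 := h3 n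
    have e1 : 2*(n+1+1) = 2*(n+1)+2 := by ring
    have e2 : 2*(n+1)+1 = 2*n+3 := by ring
    have e3 : 2*(n+1) = 2*n+2 := by ring
    rw [e1, a1, e2, a2, e3]; omega

lemma blk_of (f : ℕ → ℕ) (hf : IsFSeq f) (s : ℕ → ℕ) (hs : IsFixedSeq s) :
    Blk (fun j => (s j : ℤ)) (fun k => f (2*k)) (fun k => f (2*k+1) / 2) := by
  have hl := tauIter_length f hf
  have hh := f_half f hf
  have hr := tauIter_rec
  obtain ⟨h0, h1, h2, h3⟩ := hf
  have S := hs
  have hpS : ∀ k, f (2*(k+1)) = f (2*k) + 2 * (f (2*k+1) / 2) := fun k => by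
    rw [← (hh k).1]; exact h2 k
  have ha1 : ∀ k j, j < f (2*(k+1)) → s (f (2*(k+1)+1) + j) = s j := by
    intro k j hj
    have l0 := (hl k).1
    have l1 := (hl k).2
    have e : f (2*(k+1)+1) = f (2*k) + f (2*(k+1)) := h3 k
    have l2 := (hl (k+1)).2
    have l2' := l2
    rw [hr] at l2'
    simp only [List.length_append, l0, l1] at l2'
    rw [S (k+2) _ (by rw [l2]; omega), S (k+1) j (by rw [l1]; omega), hr]
    rw [List.getD_append_right _ _ _ _ (by simp [l0, l1]; omega)]
    congr 1
    simp [l0, l1]; omega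
  have hb1 : ∀ k j, j < f (2*k) → s (f (2*(k+1)) + j) = s j := by
    intro k j hj
    have l0 := (hl k).1
    have l1 := (hl k).2
    have l2 := (hl (k+1)).2
    have l2' := l2
    rw [hr] at l2'
    simp only [List.length_append, l0, l1] at l2'
    rw [S (k+2) _ (by rw [l2]; omega), S k j (by rw [l0]; omega), hr]
    rw [List.getD_append _ _ _ _ (by simp [l0, l1]; omega),
      List.getD_append_right _ _ _ _ (by simp [l1])]
    congr 1
    simp [l1]
  have s0 : s 0 = 1 := by rw [S 1 0 (by simp [tauIter, tau])]; simp [tauIter, tau]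
  have s1 : s 1 = 0 := by rw [S 1 1 (by simp [tauIter, tau])]; simp [tauIter, tau]
  have s2 : s 2 = 1 := by rw [S 1 2 (by simp [tauIter, tau])]; simp [tauIter, tau]
  refine ⟨by simpa using h0, by simp [h1], hpS, fun k => (hh k).2, by simp [s0], by simp [s1],
    fun j => by positivity, ?_, fun k j hj => by exact_mod_cast hb1 k j hj⟩
  intro k j hj
  rw [← (hh k).1]
  rcases k with _ | k
  · simp [h0] at hj
    subst hj
    simp [h1, s2, s0]
  · exact_mod_cast ha1 k j hj

namespace Blk
variable {u : ℕ → ℤ} {p P : ℕ → ℕ}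

lemma P_pos (B : Blk u p P) (k : ℕ) : 1 ≤ P k := by
  induction k with
  | zero => rw [B.P0]
  | succ k ih => rw [B.PS]; omega

lemma P_le (B : Blk u p P) (k : ℕ) : P k ≤ p k := by
  induction k with
  | zero => rw [B.P0, B.p0]
  | succ k ih => rw [B.PS, B.pS]; omega

lemma p_odd (B : Blk u p P) (k : ℕ) : p k % 2 = 1 := by
  induction k with
  | zero => rw [B.p0]
  | succ k ih => rw [B.pS]; omega

/-- `A_k B_k` and `B_k A_k` differ in the two middle positions only. -/
lemma hc (B : Blk u p P) (k : ℕ) : ∀ j, j < 2 * P k → u (p k + j) - u j =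
    (-1)^(k+1) * ((if j + 1 = P k then 1 else 0) - (if j = P k then 1 else 0)) := by
  induction k with
  | zero =>
    intro j hj
    rw [B.P0] at hj
    have h2 := B.ha 0 0 (by rw [B.p0]; omega)
    rw [B.P0] at h2
    simp [B.u0] at h2
    rw [B.p0, B.P0]
    interval_cases j
    · simp [B.u0, B.u1]
    · simp [B.u1, h2]
  | succ k ih =>
    intro j hj
    have e1 := B.pS k
    have e2 := B.PS k
    have e3 := B.P_pos k
    have e4 := B.P_le k
    rcases Nat.lt_or_ge j (p k) with h | h
    · rw [B.hb k j h, if_neg (by omega), if_neg (by omega)]; simp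
    rcases Nat.lt_or_ge j (p k + 2 * P k) with h' | h'
    · obtain ⟨i, rfl⟩ := Nat.exists_eq_add_of_le h
      have a1 := B.ha (k+1) i (by omega)
      have e : p (k+1) + (p k + i) = 2 * P (k+1) + i := by omega
      rw [e, a1]
      have := ih i (by omega)
      have c1 : (p k + i + 1 = P (k+1)) ↔ i + 1 = P k := by omega
      have c2 : (p k + i = P (k+1)) ↔ i = P k := by omega
      simp only [c1, c2]
      rw [pow_succ, ← neg_sub, this]; ring
    · obtain ⟨i, rfl⟩ := Nat.exists_eq_add_of_le h'
      have a1 := B.ha (k+1) (2 * P k + i) (by omega)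
      have e : p (k+1) + (p k + 2 * P k + i) = 2 * P (k+1) + (2 * P k + i) := by omega
      rw [e, a1, B.ha k i (by omega), ← e1, B.hb k i (by omega), if_neg (by omega),
        if_neg (by omega)]
      simp

lemma hc0 (B : Blk u p P) (k j : ℕ) (hj : j + 1 < P k) : u (p k + j) = u j := by
  have := B.hc k j (by omega)
  rw [if_neg (by omega), if_neg (by omega)] at this
  simp at this; linarith

end Blk

/-- the word `A_k | A_{k+1} A_{k+1} A_k` occurs at position `e - p k`. -/
structure Occ_s12 (u : ℕ → ℤ) (p : ℕ → ℕ) (k e : ℕ) : Prop where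
  ge : p k ≤ e
  z0 : ∀ i, i < p k → u (e - p k + i) = u i
  z1 : ∀ i, i < p (k+1) → u (e + i) = u i
  z2 : ∀ i, i < p (k+1) → u (e + p (k+1) + i) = u i
  z3 : ∀ i, i < p k → u (e + 2 * p (k+1) + i) = u i

lemma occ_one {u : ℕ → ℤ} {p P : ℕ → ℕ} (B : Blk u p P) (k : ℕ) : Occ_s12 u p k (2 * P (k+1)) := by
  have e1 := B.pS k
  have e2 := B.PS k
  have e3 : p (k+2) = p (k+1) + 2 * P (k+1) := B.pS (k+1)
  have e4 : P (k+2) = p (k+1) + P (k+1) := B.PS (k+1)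
  refine ⟨by omega, ?_, B.ha (k+1), ?_, ?_⟩
  · intro i hi
    rw [show 2 * P (k+1) - p k + i = p (k+1) + i by omega]; exact B.hb k i hi
  · intro i hi
    rw [show 2 * P (k+1) + p (k+1) + i = p (k+2) + i by omega]; exact B.hb (k+1) i hi
  · intro i hi
    rw [show 2 * P (k+1) + 2 * p (k+1) + i = 2 * P (k+2) + i by omega]
    exact B.ha (k+2) i (by omega)

lemma occ_two {u : ℕ → ℤ} {p P : ℕ → ℕ} (B : Blk u p P) (k : ℕ) : Occ_s12 u p k (p (k+2)) := by
  have e1 := B.pS k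
  have e2 := B.PS k
  have e3 : p (k+2) = p (k+1) + 2 * P (k+1) := B.pS (k+1)
  have e4 : P (k+2) = p (k+1) + P (k+1) := B.PS (k+1)
  refine ⟨by omega, ?_, B.hb (k+1), ?_, ?_⟩
  · intro i hi
    rw [show p (k+2) - p k + i = 2 * P (k+1) + (2 * P k + i) by omega,
      B.ha (k+1) _ (by omega), B.ha k i hi]
  · intro i hi
    rw [show p (k+2) + p (k+1) + i = 2 * P (k+2) + i by omega]
    exact B.ha (k+2) i (by omega)
  · intro i hi
    rw [show p (k+2) + 2 * p (k+1) + i = 2 * P (k+2) + (p (k+1) + i) by omega,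
      B.ha (k+2) _ (by omega), B.hb k i hi]

lemma Occ_s12.shift {u : ℕ → ℤ} {p : ℕ → ℕ} {k e : ℕ} (O : Occ_s12 u p k e) (b : ℕ)
    (h : ∀ j, j < e + 2 * p (k+1) + p k → u (b + j) = u j) : Occ_s12 u p k (b + e) := by
  have hg := O.ge
  refine ⟨by omega, ?_, ?_, ?_, ?_⟩
  · intro i hi
    rw [show b + e - p k + i = b + (e - p k + i) by omega, h _ (by omega)]; exact O.z0 i hi
  · intro i hi
    rw [show b + e + i = b + (e + i) by omega, h _ (by omega)]; exact O.z1 i hi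
  · intro i hi
    rw [show b + e + p (k+1) + i = b + (e + p (k+1) + i) by omega, h _ (by omega)]; exact O.z2 i hi
  · intro i hi
    rw [show b + e + 2 * p (k+1) + i = b + (e + 2 * p (k+1) + i) by omega, h _ (by omega)]
    exact O.z3 i hi

/-- Right contexts of block starts described by the numeration system. -/
lemma agree_s12 {u : ℕ → ℤ} {p P : ℕ → ℕ} (B : Blk u p P) (f : ℕ → ℕ) (hp : ∀ k, f (2*k) = p k)
    (hP : ∀ k, f (2*k+1) = 2 * P k) (n : ℕ) (a : ℕ → ℕ) (ha : IsFRep f n a) (K : ℕ) :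
    ∀ b, n = ∑ i ∈ Finset.range (2*K+1), a i * f i + b →
      (∀ j, j + 1 < P (K+1) → u (b + j) = u j) ∧
      (a (2*K) = 1 → ∀ j, j < p (K+1) → u (b + j) = u j) := by
  obtain ⟨d1, d2, d3, N, hN, hn⟩ := ha
  have big : ∀ K, N ≤ 2*K+1 → ∀ b, n = ∑ i ∈ Finset.range (2*K+1), a i * f i + b → b = 0 := by
    intro K hK b hb
    have : ∑ i ∈ Finset.range (2*K+1), a i * f i = ∑ i ∈ Finset.range N, a i * f i := by
      symm
      apply Finset.sum_subset
      · intro x; simp; omega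
      · intro x _ hx; simp at hx; rw [hN x hx]; simp
    omega
  have hle : ∀ M, ∑ i ∈ Finset.range M, a i * f i ≤ n := by
    intro M
    rcases Nat.le_total M N with h | h
    · rw [hn]
      exact Finset.sum_le_sum_of_subset (by intro x; simp; omega)
    · rw [hn]
      refine (Finset.sum_subset (s₁ := Finset.range N) ?_ ?_).ge
      · intro x; simp; omega
      · intro x _ hx; simp at hx; rw [hN x hx]; simp
  rcases Nat.lt_or_ge N K with h | h
  · intro b hb
    have := big K (by omega) b hb
    subst this; simp
  induction h using Nat.decreasingInduction with
  | self =>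
    intro b hb
    have := big N (by omega) b hb
    subst this; simp
  | of_succ K hK ih =>
    intro b hb
    have e1 := B.pS K
    have e2 := B.PS K
    have e3 : p (K+2) = p (K+1) + 2 * P (K+1) := B.pS (K+1)
    have e4 : P (K+2) = p (K+1) + P (K+1) := B.PS (K+1)
    have e5 := B.P_pos K
    have e6 := B.P_le K
    have q0 := d1 (2*K)
    have q1 := d1 (2*K+1)
    have q2 := d1 (2*K+2)
    have r0 := d2 (2*K)
    have r1 := d2 (2*K+1)
    have r2 := d3 (2*K) (by simp)
    have hsum : ∑ i ∈ Finset.range (2*(K+1)+1), a i * f i =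
        ∑ i ∈ Finset.range (2*K+1), a i * f i + a (2*K+1) * (2 * P K) + a (2*K+2) * p (K+1) := by
      rw [show 2*(K+1)+1 = 2*K+1+1+1 by ring, Finset.sum_range_succ, Finset.sum_range_succ, hP,
        show 2*K+1+1 = 2*(K+1) by ring, hp]
    obtain ⟨b', hb'⟩ := Nat.exists_eq_add_of_le (hle (2*(K+1)+1))
    obtain ⟨i0, i1⟩ := ih b' hb'
    change ∀ j, j + 1 < P (K+2) → _ at i0
    change a (2*K+2) = 1 → ∀ j, j < p (K+2) → _ at i1
    have hbb : b = a (2*K+1) * (2 * P K) + a (2*K+2) * p (K+1) + b' := by omega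
    have q1' : a (2*K+1) = 0 ∨ a (2*K+1) = 1 := by omega
    have q2' : a (2*K+2) = 0 ∨ a (2*K+2) = 1 := by omega
    rcases q2' with z2 | z2
    · rcases q1' with z1 | z1
      · have : b = b' := by rw [hbb, z1, z2]; ring
        subst this
        exact ⟨fun j hj => i0 j (by omega), fun _ j hj => i0 j (by omega)⟩
      · have : b = b' + 2 * P K := by rw [hbb, z1, z2]; ring
        subst this
        rw [z1] at r0
        refine ⟨fun j hj => ?_, fun h => by omega⟩
        rw [add_assoc, i0 _ (by omega)]
        rcases Nat.lt_or_ge j (p K) with h | h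
        · exact B.ha K j h
        · obtain ⟨i, rfl⟩ := Nat.exists_eq_add_of_le h
          rw [show 2 * P K + (p K + i) = p (K+1) + i by omega, B.hc0 (K+1) i (by omega),
            B.hc0 K i (by omega)]
    · rw [z2] at r1 r2
      have z1 : a (2*K+1) = 0 := by omega
      have : b = b' + p (K+1) := by rw [hbb, z1, z2]; ring
      subst this
      refine ⟨fun j hj => ?_, fun h => by omega⟩
      rw [add_assoc, i1 z2 _ (by omega), B.hc0 (K+1) j hj]

namespace Occ_s12
variable {u : ℕ → ℤ} {p P : ℕ → ℕ} {k e : ℕ}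

lemma dz (B : Blk u p P) (O : Occ_s12 u p k e) (x : ℕ) (h1 : P k ≤ x) (h2 : x < p (k+1) + P k) :
    u (e + x + p k) - u (e + x) = (-1)^(k+1) *
      ((if x + 1 = p (k+1) + P k then 1 else 0) - (if x = P k then 1 else 0)) := by
  have e1 := B.pS k
  have e2 := B.P_pos k
  have e3 := B.P_le k
  rcases Nat.lt_or_ge x (2 * P k) with h | h
  · rw [show e + x + p k = e + (p k + x) by omega, O.z1 _ (by omega), O.z1 _ (by omega),
      B.hc k x h, if_neg (show ¬ x + 1 = P k by omega),
      if_neg (show ¬ x + 1 = p (k+1) + P k by omega)]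
  rcases Nat.lt_or_ge x (p (k+1)) with h' | h'
  · obtain ⟨y, rfl⟩ := Nat.exists_eq_add_of_le h
    rw [O.z1 _ h', B.ha k y (by omega), show e + (2 * P k + y) + p k = e + p (k+1) + y by omega,
      O.z2 _ (by omega), if_neg (by omega), if_neg (by omega)]
    simp
  · obtain ⟨y, rfl⟩ := Nat.exists_eq_add_of_le h'
    have c1 : (p (k+1) + y + 1 = p (k+1) + P k) ↔ y + 1 = P k := by omega
    rw [show e + (p (k+1) + y) + p k = e + p (k+1) + (p k + y) by omega, O.z2 _ (by omega),
      ← add_assoc, O.z2 _ (by omega), B.hc k y (by omega), if_neg (show ¬ y = P k by omega),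
      if_neg (show ¬ p (k+1) + y = P k by omega)]
    simp only [c1]

lemma per (B : Blk u p P) (O : Occ_s12 u p k e) (j : ℕ) (h1 : e + 2 ≤ j + P k)
    (h2 : j + 2 < e + p (k+1) + P k) : u (j + p (k+1)) = u j := by
  have e1 := B.pS k
  have e2 := B.P_pos k
  have e3 := B.P_le k
  have hg := O.ge
  rcases Nat.lt_or_ge j e with h | h
  · obtain ⟨i, rfl⟩ : ∃ i, j = e - p k + i := ⟨j + p k - e, by omega⟩
    rw [O.z0 _ (by omega), show e - p k + i + p (k+1) = e + (2 * P k + i) by omega,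
      O.z1 _ (by omega), B.ha k i (by omega)]
  obtain ⟨i, rfl⟩ := Nat.exists_eq_add_of_le h
  rcases Nat.lt_or_ge i (p (k+1)) with h' | h'
  · rw [O.z1 _ h', show e + i + p (k+1) = e + p (k+1) + i by omega, O.z2 _ h']
  · obtain ⟨y, rfl⟩ := Nat.exists_eq_add_of_le h'
    rw [show e + (p (k+1) + y) + p (k+1) = e + 2 * p (k+1) + y by omega, O.z3 _ (by omega),
      ← add_assoc, O.z2 _ (by omega)]

end Occ_s12

lemma sgn_succ (k r : ℕ) : (-1 : ℤ)^((r+1)*k) * (-1 : ℤ)^((r+1)*(r+1+1)/2) =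
    (-1)^(k+r+1) * ((-1 : ℤ)^(r*k) * (-1 : ℤ)^(r*(r+1)/2)) := by
  have : (r+1)*(r+1+1)/2 = r*(r+1)/2 + (r+1) := by
    rw [show (r+1)*(r+1+1) = r*(r+1) + (r+1)*2 by ring, Nat.add_mul_div_right _ _ (by norm_num)]
  rw [this]; ring

lemma neg_one_pow_parity (a b : ℕ) (h : a % 2 = b % 2) : (-1 : ℤ)^a = (-1)^b := by
  rw [neg_one_pow_eq_pow_mod_two, h, ← neg_one_pow_eq_pow_mod_two]

lemma flip_sign (c : ℕ) (x y : ℤ) (h : x = (-1)^c * y) : y = (-1)^c * x := by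
  rw [h, ← mul_assoc, ← mul_pow]; simp

lemma partI {u : ℕ → ℤ} {p P : ℕ → ℕ} {k e : ℕ} (B : Blk u p P) (O : Occ_s12 u p k e) (r : ℕ)
    (hr : r + 1 ≤ 2 * P k) : Hz u (e + P k + 2 + r - 2 * P k) (p (k+1) - 1 - r) =
      (-1)^(r*k) * (-1)^(r*(r+1)/2) * Hz u (e + P k + 2 - 2 * P k) (p (k+1) - 1) := by
  have e1 := B.pS k
  have e2 := B.P_pos k
  have e3 := B.P_le k
  have e4 := B.p_odd (k+1)
  have hg := O.ge
  induction r with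
  | zero => simp
  | succ r ih =>
    rw [sgn_succ, mul_assoc, ← ih (by omega)]
    obtain ⟨N, hN⟩ : ∃ N, p (k+1) - 1 - r = N + 1 := ⟨p (k+1) - 2 - r, by omega⟩
    have st := stepI u (e + P k + 2 + r - 2 * P k) N (p k) (e + P k) ((-1)^k) (by omega)
      (by omega) (by omega) ?_ ?_
    · rw [hN, show p (k+1) - 1 - (r+1) = N by omega,
        show e + P k + 2 + (r+1) - 2 * P k = e + P k + 2 + r - 2 * P k + 1 by omega]
      apply flip_sign
      rw [st, ← pow_add, neg_one_pow_parity (N + k) (k+r+1) (by omega)]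
    · have := O.dz B (P k) le_rfl (by omega)
      rw [this, if_neg (by omega), if_pos rfl]; ring
    · intro j h1 h2
      have := O.dz B (P k + j) (by omega) (by omega)
      rw [if_neg (by omega), if_neg (by omega)] at this
      rw [show e + P k + p k + j = e + (P k + j) + p k by ring,
        show e + P k + j = e + (P k + j) by ring]
      linarith

lemma partII {u : ℕ → ℤ} {p P : ℕ → ℕ} {k e : ℕ} (B : Blk u p P) (O : Occ_s12 u p k e) (r : ℕ)
    (hr : r + 1 ≤ 2 * P k) : Hz u (e + P k + 1 + r) (p (k+1) - 1 - r) =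
      (-1)^(r*k) * (-1)^(r*(r+1)/2) * Hz u (e + P k + 1) (p (k+1) - 1) := by
  have e1 := B.pS k
  have e2 := B.P_pos k
  have e3 := B.P_le k
  have e4 := B.p_odd (k+1)
  have hg := O.ge
  induction r with
  | zero => simp
  | succ r ih =>
    rw [sgn_succ, mul_assoc, ← ih (by omega)]
    obtain ⟨N, hN⟩ : ∃ N, p (k+1) - 1 - r = N + 1 := ⟨p (k+1) - 2 - r, by omega⟩
    have st := stepII u (e + P k + 1 + r) N (p k) ((-1)^(k+1)) (by omega) (by omega) ?_ ?_
    · rw [hN, show p (k+1) - 1 - (r+1) = N by omega, ← add_assoc]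
      apply flip_sign
      rw [st, show (-(-1)^(k+1) : ℤ) = (-1)^k by ring, ← pow_add,
        neg_one_pow_parity (N + k) (k+r+1) (by omega)]
    · have := O.dz B (P k + 1 + r + N) (by omega) (by omega)
      rw [show e + P k + 1 + r + p k + N = e + (P k + 1 + r + N) + p k by ring,
        show e + P k + 1 + r + N = e + (P k + 1 + r + N) by ring, this, if_pos (by omega),
        if_neg (by omega)]; ring
    · intro j h2
      have := O.dz B (P k + 1 + r + j) (by omega) (by omega)
      rw [if_neg (by omega), if_neg (by omega)] at this
      rw [show e + P k + 1 + r + p k + j = e + (P k + 1 + r + j) + p k by ring,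
        show e + P k + 1 + r + j = e + (P k + 1 + r + j) by ring]
      linarith

lemma partIII {u : ℕ → ℤ} {p P : ℕ → ℕ} {k e : ℕ} (B : Blk u p P) (O : Occ_s12 u p k e) (r : ℕ)
    (hr : r + 1 ≤ 2 * P k) : Hz u (e + P k + 2 + r - 2 * P k) (p (k+1) - 1) =
      Hz u (e + P k + 1) (p (k+1) - 1) := by
  have e1 := B.pS k
  have e2 := B.P_pos k
  have e3 := B.P_le k
  have e4 := B.p_odd (k+1)
  have hg := O.ge
  have key : ∀ r, r + 1 ≤ 2 * P k → Hz u (e + P k + 2 + r - 2 * P k) (p (k+1) - 1) =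
      Hz u (e + P k + 2 - 2 * P k) (p (k+1) - 1) := by
    intro r hr
    induction r with
    | zero => simp
    | succ r ih =>
      rw [← ih (by omega)]
      obtain ⟨N, hN⟩ : ∃ N, p (k+1) - 1 = N + 1 := ⟨p (k+1) - 2, by omega⟩
      rw [hN, show e + P k + 2 + (r+1) - 2 * P k = e + P k + 2 + r - 2 * P k + 1 by omega]
      set m := e + P k + 2 + r - 2 * P k with hm
      have hU := sum_window_const u (e + P k + 1) (p k) N (by
        intro j hj
        have := O.dz B (P k + 1 + j) (by omega) (by omega)
        rw [if_neg (by omega), if_neg (by omega)] at this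
        rw [show e + P k + 1 + j = e + (P k + 1 + j) by ring]
        linarith)
      refine stepIII u m N (p k) (e + P k + 1) _ _ (Nat.odd_iff.2 (by omega)) ?_ (by omega)
        (by omega) (sum_window_const u m (N+2) N ?_) hU
      · rw [← hU (p (k+1) - P k - 1) (by omega)]
        have : ∀ l ∈ Finset.range (p k), u (e + P k + 1 + (p (k+1) - P k - 1) + l) = u l := by
          intro l hl
          rw [Finset.mem_range] at hl
          rw [show e + P k + 1 + (p (k+1) - P k - 1) + l = e + p (k+1) + l by omega]
          exact O.z2 l (by omega)
        rw [Finset.sum_congr rfl this]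
        have := Finset.single_le_sum (f := u) (fun i _ => B.nn i)
          (Finset.mem_range.2 (show 0 < p k by omega))
        rw [B.u0] at this
        exact (lt_of_lt_of_le zero_lt_one this).ne'
      · intro j hj
        rw [show N + 2 = p (k+1) by omega]
        exact O.per B _ (by omega) (by omega)
  rw [key r hr, ← key (2 * P k - 1) (by omega)]
  congr 1
  omega


theorem boundary_V (f : ℕ → ℕ) (hf : IsFSeq f) (s : ℕ → ℕ) (hs : IsFixedSeq s) (a : ℕ → ℕ → ℕ) (ha : ∀ n, IsFRep f n (a n)) :
    ∀ k β' r : ℕ,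
      Phi f a k β' = f (2*k+1) / 2 → Phi f a (k+1) β' ≠ f (2*k+1) / 2 →
      r ≤ f (2*k+1) - 1 →
      (H s (β' + 2 + r - f (2*k+1)) (f (2*k+2) - 1 - r) =
          (-1 : ℤ)^(r*k) * (-1 : ℤ)^(r*(r+1)/2) *
            H s (β' + 2 - f (2*k+1)) (f (2*k+2) - 1)) ∧
      (H s (β' + 1 + r) (f (2*k+2) - 1 - r) =
          (-1 : ℤ)^(r*k) * (-1 : ℤ)^(r*(r+1)/2) * H s (β' + 1) (f (2*k+2) - 1)) ∧
      (H s (β' + 2 + r - f (2*k+1)) (f (2*k+2) - 1) = H s (β' + 1) (f (2*k+2) - 1)) := by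
  intro k β' r h1 h2 hr
  have B := blk_of f hf s hs
  have hh := fun k => (f_half f hf k).1
  obtain ⟨p, hp⟩ : ∃ p : ℕ → ℕ, p = fun k => f (2*k) := ⟨_, rfl⟩
  obtain ⟨P, hP⟩ : ∃ P : ℕ → ℕ, P = fun k => f (2*k+1) / 2 := ⟨_, rfl⟩
  obtain ⟨u, hu⟩ : ∃ u : ℕ → ℤ, u = fun j => (s j : ℤ) := ⟨_, rfl⟩
  rw [← hp, ← hP, ← hu] at B
  have fp : ∀ k, f (2*k) = p k := fun k => by rw [hp]
  have fP : ∀ k, f (2*k+1) = 2 * P k := fun k => by rw [hP]; exact hh k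
  have fq : f (2*k+2) = p (k+1) := fp (k+1)
  simp only [H_eq_Hz, ← hu]
  rw [fP] at h1 h2 hr
  rw [Nat.mul_div_cancel_left _ (by norm_num)] at h1 h2
  rw [fP, fq]
  have hsum : ∑ i ∈ Finset.range (2*(k+2)+1), a β' i * f i =
      P k + a β' (2*k+3) * (2 * P (k+1)) + a β' (2*k+4) * p (k+2) := by
    rw [← h1, Phi, show 2*(k+2)+1 = 2*k+3+1+1 by ring, Finset.sum_range_succ,
      Finset.sum_range_succ, show 2*k+3+1 = 2*(k+2) by ring, fp,
      show 2*k+3 = 2*(k+1)+1 by ring, fP]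
  have h2' : P k + a β' (2*k+3) * (2 * P (k+1)) + a β' (2*k+4) * p (k+2) ≠ P k := by
    rw [← hsum]; exact h2
  obtain ⟨d1, d2, d3, N, hN, hn⟩ := ha β'
  have hle : ∑ i ∈ Finset.range (2*(k+2)+1), a β' i * f i ≤ β' := by
    conv_rhs => rw [hn]
    rcases Nat.le_total (2*(k+2)+1) N with h | h
    · exact Finset.sum_le_sum_of_subset (by intro x; simp; omega)
    · refine (Finset.sum_subset (s₁ := Finset.range N) ?_ ?_).ge
      · intro x; simp; omega
      · intro x _ hx; simp at hx; rw [hN x hx]; simp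
  obtain ⟨b, hb⟩ := Nat.exists_eq_add_of_le hle
  obtain ⟨g0, g1⟩ := agree_s12 B f fp fP β' (a β') (ha β') (k+2) b hb
  have e1 := B.pS k
  have e2 := B.PS k
  have e3 : p (k+2) = p (k+1) + 2 * P (k+1) := B.pS (k+1)
  have e4 : P (k+2) = p (k+1) + P (k+1) := B.PS (k+1)
  have e5 : P (k+3) = p (k+2) + P (k+2) := B.PS (k+2)
  have e6 : p (k+3) = p (k+2) + 2 * P (k+2) := B.pS (k+2)
  have e7 := B.P_pos k
  change ∀ j, j + 1 < P (k+3) → _ at g0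
  change a β' (2*k+4) = 1 → ∀ j, j < p (k+3) → _ at g1
  have x3 := d1 (2*k+3)
  have x4 := d1 (2*k+4)
  have x34 := d2 (2*k+3)
  change a β' (2*k+3) * a β' (2*k+4) = 0 at x34
  obtain ⟨e, O, hβ⟩ : ∃ e, Occ_s12 u p k e ∧ β' = e + P k := by
    rcases Nat.eq_zero_or_pos (a β' (2*k+4)) with z | z
    · have z3 : a β' (2*k+3) = 1 := by
        rcases Nat.eq_zero_or_pos (a β' (2*k+3)) with y | y
        · rw [y, z] at h2'; simp at h2'
        · omega
      refine ⟨b + 2 * P (k+1), (occ_one B k).shift b (fun j hj => g0 j (by omega)), ?_⟩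
      rw [hsum, z, z3] at hb; omega
    · have z4 : a β' (2*k+4) = 1 := by omega
      rw [z4] at x34
      have z3 : a β' (2*k+3) = 0 := by omega
      refine ⟨b + p (k+2), (occ_two B k).shift b (fun j hj => g1 z4 j (by omega)), ?_⟩
      rw [hsum, z4, z3] at hb; omega
  subst hβ
  exact ⟨partI B O r (by omega), partII B O r (by omega), partIII B O r (by omega)⟩
end
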